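/- For every integer m ≥ 1 and every γ > 0 there exists an integer n₀ such that for every n ≥ n₀ divisible by 4m, every 4-graph H on n vertices with minimum vertex degree δ₁(H) ≥ (37/64 + γ)·C(n,3) contains a K₄⁴(m)-factor. -/

import Mathlib

open Finset

/-- `A` is the vertex set of a copy of the hypergraph with vertex type `V` and edge set `EF`
inside the hypergraph on `Fin n` with edge set `E`. -/
def IsCopy {n : ℕ} {V : Type} [Fintype V] [DecidableEq V] (E : Finset (Finset (Fin n)))
    (EF : Finset (Finset V)) (A : Finset (Fin n)) : Prop :=
  ∃ f : V ↪ Fin n, Finset.map f Finset.univ = A ∧ ∀ e ∈ EF, e.map f ∈ E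

/-- The induced subhypergraph of `E` on `S` has an `F`-factor, where `F` has vertex type `V`
and edge set `EF`: there are pairwise vertex-disjoint copies of `F` covering exactly `S`. -/
def HasFactorOn {n : ℕ} {V : Type} [Fintype V] [DecidableEq V] (E : Finset (Finset (Fin n)))
    (EF : Finset (Finset V)) (S : Finset (Fin n)) : Prop :=
  ∃ P : Finset (Finset (Fin n)), (∀ A ∈ P, IsCopy E EF A) ∧
    (P : Set (Finset (Fin n))).PairwiseDisjoint id ∧ P.biUnion id = S

/-- `x` is `(F, i, η)`-close to `y`. -/
def CloseTo {n : ℕ} {V : Type} [Fintype V] [DecidableEq V] (E : Finset (Finset (Fin n)))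
    (EF : Finset (Finset V)) (i : ℕ) (η : ℝ) (x y : Fin n) : Prop :=
  η * (n : ℝ) ^ (i * Fintype.card V - 1) ≤
    (({S : Finset (Fin n) | S.card = i * Fintype.card V - 1 ∧ x ∉ S ∧ y ∉ S ∧
      HasFactorOn E EF (insert x S) ∧ HasFactorOn E EF (insert y S)}).ncard : ℝ)

/-- `H` is `(F, i, η)`-closed. -/
def IsClosedGraph {n : ℕ} {V : Type} [Fintype V] [DecidableEq V] (E : Finset (Finset (Fin n)))
    (EF : Finset (Finset V)) (i : ℕ) (η : ℝ) : Prop :=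
  ∀ x y : Fin n, x ≠ y → CloseTo E EF i η x y

/-- `Ñ_{F,i,η}(x)`: the set of vertices `(F, i, η)`-close to `x`. -/
def Ntilde {n : ℕ} {V : Type} [Fintype V] [DecidableEq V] (E : Finset (Finset (Fin n)))
    (EF : Finset (Finset V)) (i : ℕ) (η : ℝ) (x : Fin n) : Set (Fin n) :=
  {y | CloseTo E EF i η x y}

/-- Degree of the set `T` in the `k`-graph with edge set `E`. -/
noncomputable def degOn {n : ℕ} (E : Finset (Finset (Fin n))) (k : ℕ) (T : Finset (Fin n)) : ℕ :=
  ({S : Finset (Fin n) | S.card = k - T.card ∧ Disjoint S T ∧ S ∪ T ∈ E}).ncard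

/-- Edge set of the complete `k`-graph `K_t^k` on `Fin t`. -/
def cliqueEdges (t k : ℕ) : Finset (Finset (Fin t)) :=
  Finset.powersetCard k (Finset.univ : Finset (Fin t))

/-- Edge set of the complete `k`-partite `k`-graph `K_k^k(m)` with parts of size `m`. -/
def multipartiteEdges (k m : ℕ) : Finset (Finset (Fin k × Fin m)) :=
  Finset.univ.filter (fun e : Finset (Fin k × Fin m) =>
    ∀ i : Fin k, (e.filter (fun v => v.1 = i)).card = 1)

theorem ineq_three_singles {x y z : ℝ} (hx : 0 ≤ x) (hy : 0 ≤ y) (hz : 0 ≤ z)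
    (hx1 : x ≤ 1) (hy1 : y ≤ 1) (hz1 : z ≤ 1) :
    27 * (1 + x + y + z) ^ 3 ≤ 64 * ((1 + y + z) * (1 + x + z) * (1 + x + y)) := by
  nlinarith [mul_nonneg hx hy, mul_nonneg hx hz, mul_nonneg hy hz, mul_nonneg (mul_nonneg hx hy) hz,
    mul_nonneg (sub_nonneg.2 hx1) (sub_nonneg.2 hy1),
    mul_nonneg (sub_nonneg.2 hx1) (sub_nonneg.2 hz1),
    mul_nonneg (sub_nonneg.2 hz1) (sub_nonneg.2 hy1),
    mul_nonneg (mul_nonneg (sub_nonneg.2 hx1) (sub_nonneg.2 hy1)) (sub_nonneg.2 hz1),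
    mul_nonneg (mul_nonneg (sub_nonneg.2 hx1) (sub_nonneg.2 hy1)) hz,
    mul_nonneg (mul_nonneg (sub_nonneg.2 hx1) (sub_nonneg.2 hz1)) hy,
    mul_nonneg (mul_nonneg (sub_nonneg.2 hz1) (sub_nonneg.2 hy1)) hx,
    mul_nonneg (mul_nonneg (sub_nonneg.2 hx1) hy) hz,
    mul_nonneg (mul_nonneg (sub_nonneg.2 hy1) hx) hz,
    mul_nonneg (mul_nonneg (sub_nonneg.2 hz1) hx) hy, sq_nonneg (x - y), sq_nonneg (x - z),
    sq_nonneg (y - z),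
    mul_nonneg hx (mul_nonneg hx (sub_nonneg.2 hx1)),
    mul_nonneg hy (mul_nonneg hy (sub_nonneg.2 hy1)),
    mul_nonneg hz (mul_nonneg hz (sub_nonneg.2 hz1)),
    mul_nonneg hx (sub_nonneg.2 hx1), mul_nonneg hy (sub_nonneg.2 hy1),
    mul_nonneg hz (sub_nonneg.2 hz1)]

theorem ineq_two_singles {x y : ℝ} (hx : 0 ≤ x) (hy : 0 ≤ y) (hx1 : x ≤ 1) (hy1 : y ≤ 1) :
    4 * (1 + x + y) ^ 2 ≤ 9 * ((1 + x) * (1 + y)) := by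
  nlinarith [mul_nonneg hx hy, mul_nonneg (sub_nonneg.2 hx1) (sub_nonneg.2 hy1),
    mul_nonneg hx (sub_nonneg.2 hx1), mul_nonneg hy (sub_nonneg.2 hy1)]

theorem ineq_median {u x y : ℝ} (hu : 0 ≤ u) (hx : 0 ≤ x) (hy : 0 ≤ y) (hu1 : u ≤ 1)
    (hx1 : x ≤ 1) (hy1 : y ≤ 1) :
    64 * ((x + y) * (u + x + y) - u * x * y) ≤ 37 * ((2 - u) * (u + x + y) ^ 2) := by
  nlinarith [mul_nonneg hx hy, mul_nonneg hx hu, mul_nonneg hu hy, mul_nonneg (mul_nonneg hx hy) hu,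
    mul_nonneg (sub_nonneg.2 hx1) (sub_nonneg.2 hy1),
    mul_nonneg (sub_nonneg.2 hx1) (sub_nonneg.2 hu1),
    mul_nonneg (sub_nonneg.2 hu1) (sub_nonneg.2 hy1),
    mul_nonneg (mul_nonneg (sub_nonneg.2 hx1) (sub_nonneg.2 hu1)) hx,
    mul_nonneg (mul_nonneg (sub_nonneg.2 hy1) (sub_nonneg.2 hu1)) hy,
    mul_nonneg (mul_nonneg (sub_nonneg.2 hx1) hu) hx,
    mul_nonneg (mul_nonneg (sub_nonneg.2 hy1) hu) hy,
    mul_nonneg (mul_nonneg (sub_nonneg.2 hu1) hu) hu,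
    mul_nonneg (mul_nonneg (sub_nonneg.2 hu1) hu) hx,
    mul_nonneg (mul_nonneg (sub_nonneg.2 hu1) hu) hy,
    mul_nonneg (mul_nonneg (sub_nonneg.2 hu1) hy) hy,
    mul_nonneg (mul_nonneg (sub_nonneg.2 hu1) hx) hx,
    mul_nonneg (mul_nonneg (sub_nonneg.2 hu1) hx) hy,
    mul_nonneg (sub_nonneg.2 hu1) (sq_nonneg (x - y)), mul_nonneg hu (sq_nonneg (x - y))]

/-- Parameters of a two-point law with mean `1` on the values `1 - α` and `1 + β`, the latter
having probability `p`. -/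
structure TwoPoint (α β p : ℝ) : Prop where
  α_nonneg : 0 ≤ α
  α_le : α ≤ 1
  β_nonneg : 0 ≤ β
  p_nonneg : 0 ≤ p
  p_le : p ≤ 1
  mean : p * β = (1 - p) * α

namespace TwoPoint

variable {α β p α₁ β₁ p₁ α₂ β₂ p₂ α₃ β₃ p₃ : ℝ}

theorem p_mul_le (h : TwoPoint α β p) : p * (1 + β) ≤ 1 := by
  nlinarith [h.mean, mul_nonneg (sub_nonneg.2 h.p_le) (sub_nonneg.2 h.α_le)]

theorem p_le_div {s : ℝ} (h : TwoPoint α β p) (hs : 0 < s) (hs' : s ≤ α + β) : p ≤ α / s := by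
  rw [le_div_iff₀ hs]
  nlinarith [h.mean, mul_nonneg h.p_nonneg (sub_nonneg.2 hs')]

theorem p_le_half (h : TwoPoint α β p) (hβ : 1 ≤ β) : p ≤ 1 / 2 := by
  nlinarith [h.p_mul_le, mul_nonneg h.p_nonneg (sub_nonneg.2 hβ)]

theorem three_singles (h₁ : TwoPoint α₁ β₁ p₁) (h₂ : TwoPoint α₂ β₂ p₂) (h₃ : TwoPoint α₃ β₃ p₃)
    (c₁ : 1 + α₂ + α₃ ≤ β₁) (c₂ : 1 + α₁ + α₃ ≤ β₂) (c₃ : 1 + α₁ + α₂ ≤ β₃) :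
    27 / 64 ≤ (1 - p₁) * (1 - p₂) * (1 - p₃) := by
  have a₁ := h₁.α_nonneg
  have a₂ := h₂.α_nonneg
  have a₃ := h₃.α_nonneg
  have hs : 0 < 1 + α₁ + α₂ + α₃ := by linarith
  have e₁ : (1 + α₂ + α₃) / (1 + α₁ + α₂ + α₃) ≤ 1 - p₁ := by
    have := h₁.p_le_div hs (by linarith)
    have e : (1 + α₂ + α₃) / (1 + α₁ + α₂ + α₃) = 1 - α₁ / (1 + α₁ + α₂ + α₃) := by
      field_simp; ring
    linarith
  have e₂ : (1 + α₁ + α₃) / (1 + α₁ + α₂ + α₃) ≤ 1 - p₂ := by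
    have := h₂.p_le_div hs (by linarith)
    have e : (1 + α₁ + α₃) / (1 + α₁ + α₂ + α₃) = 1 - α₂ / (1 + α₁ + α₂ + α₃) := by
      field_simp; ring
    linarith
  have e₃ : (1 + α₁ + α₂) / (1 + α₁ + α₂ + α₃) ≤ 1 - p₃ := by
    have := h₃.p_le_div hs (by linarith)
    have e : (1 + α₁ + α₂) / (1 + α₁ + α₂ + α₃) = 1 - α₃ / (1 + α₁ + α₂ + α₃) := by
      field_simp; ring
    linarith
  calc (27 : ℝ) / 64 ≤ (1 + α₂ + α₃) / (1 + α₁ + α₂ + α₃) *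
        ((1 + α₁ + α₃) / (1 + α₁ + α₂ + α₃)) * ((1 + α₁ + α₂) / (1 + α₁ + α₂ + α₃)) := by
        have := ineq_three_singles a₁ a₂ a₃ h₁.α_le h₂.α_le h₃.α_le
        rw [div_mul_div_comm, div_mul_div_comm, div_le_div_iff₀ (by norm_num) (by positivity)]
        nlinarith
    _ ≤ _ := by
        have : 0 ≤ 1 - p₂ := sub_nonneg.2 h₂.p_le
        have : 0 ≤ 1 - p₁ := sub_nonneg.2 h₁.p_le
        gcongr

theorem four_ninths_le {x y s t : ℝ} (hx : 0 ≤ x) (hy : 0 ≤ y) (hx1 : x ≤ 1) (hy1 : y ≤ 1)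
    (hs : (1 + x) / (1 + x + y) ≤ s) (ht : (1 + y) / (1 + x + y) ≤ t) : 4 / 9 ≤ s * t := by
  calc (4 : ℝ) / 9 ≤ (1 + x) / (1 + x + y) * ((1 + y) / (1 + x + y)) := by
        have := ineq_two_singles hx hy hx1 hy1
        rw [div_mul_div_comm, div_le_div_iff₀ (by norm_num) (by positivity)]
        nlinarith
    _ ≤ _ := by
        have : 0 ≤ s := le_trans (by positivity) hs
        gcongr

theorem one_sub_ge {x y : ℝ} (h : TwoPoint α β p) (hx : 0 ≤ x) (hα : α ≤ y)
    (hβ : 1 + x ≤ β) : (1 + x) / (1 + x + y) ≤ 1 - p := by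
  have a := h.α_nonneg
  have h1 := h.p_le_div (s := 1 + x + α) (by linarith) (by linarith)
  have h2 : α / (1 + x + α) ≤ y / (1 + x + y) := by
    rw [div_le_div_iff₀ (by linarith) (by linarith)]
    nlinarith
  have e : (1 + x) / (1 + x + y) = 1 - y / (1 + x + y) := by
    have : 1 + x + y ≠ 0 := by linarith
    field_simp; ring
  linarith

theorem two_singles (h₁ : TwoPoint α₁ β₁ p₁) (h₂ : TwoPoint α₂ β₂ p₂)
    (c₁ : 1 + α₂ ≤ β₁) (c₂ : 1 + α₁ ≤ β₂) :
    4 / 9 ≤ (1 - p₁) * (1 - p₂) := by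
  refine four_ninths_le (x := α₂) (y := α₁) h₂.α_nonneg h₁.α_nonneg h₂.α_le h₁.α_le
    (h₁.one_sub_ge h₂.α_nonneg le_rfl c₁) ?_
  have := h₂.one_sub_ge h₁.α_nonneg le_rfl c₂
  rwa [add_right_comm] at this

theorem mul_le_div_max (h₁ : TwoPoint α₁ β₁ p₁) (h₂ : TwoPoint α₂ β₂ p₂) {x : ℝ} (hx : 0 ≤ x)
    (h : α₁ ≤ α₂) (c : 1 + x ≤ β₁ + β₂) : p₁ * p₂ ≤ α₂ / (1 + x + α₂) := by
  have a₁ := h₁.α_nonneg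
  have a₂ := h₂.α_nonneg
  rw [le_div_iff₀ (by linarith)]
  have m₁ := h₁.mean
  have m₂ := h₂.mean
  have b₁ := h₁.β_nonneg
  have b₂ := h₂.β_nonneg
  have P : p₁ * p₂ * ((α₁ + β₁) * (α₂ + β₂)) = α₁ * α₂ := by
    have e₁ : p₁ * (α₁ + β₁) = α₁ := by linarith
    have e₂ : p₂ * (α₂ + β₂) = α₂ := by linarith
    calc _ = (p₁ * (α₁ + β₁)) * (p₂ * (α₂ + β₂)) := by ring
      _ = _ := by rw [e₁, e₂]
  have Q : α₁ * (1 + x + α₂) ≤ (α₁ + β₁) * (α₂ + β₂) := by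
    nlinarith [mul_nonneg a₁ (sub_nonneg.2 c), mul_nonneg b₁ (sub_nonneg.2 h), mul_nonneg b₁ b₂]
  have pp : 0 ≤ p₁ * p₂ := mul_nonneg h₁.p_nonneg h₂.p_nonneg
  rcases a₁.eq_or_lt with h0 | h0
  · by_cases hp : p₁ = 0
    · simp [hp, a₂]
    · have : β₁ = 0 := by
        rw [← h0] at m₁
        simpa [hp] using m₁
      have hb2 : 1 + x ≤ β₂ := by linarith
      have : p₁ * p₂ ≤ p₂ := by nlinarith [h₁.p_le, h₂.p_nonneg]
      nlinarith [h₂.p_nonneg, mul_nonneg h₂.p_nonneg (sub_nonneg.2 hb2)]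
  · have : α₁ * (p₁ * p₂ * (1 + x + α₂)) ≤ α₁ * α₂ := by
      nlinarith [mul_le_mul_of_nonneg_left Q pp]
    exact le_of_mul_le_mul_left this h0

theorem single_double (h₁ : TwoPoint α₁ β₁ p₁) (h₂ : TwoPoint α₂ β₂ p₂) (h₃ : TwoPoint α₃ β₃ p₃)
    (c₁ : 1 + α₂ + α₃ ≤ β₁) (c₂ : 1 + α₁ ≤ β₂ + β₃) :
    4 / 9 ≤ (1 - p₁) * (1 - p₂ * p₃) := by
  wlog h : α₂ ≤ α₃ generalizing α₂ α₃ β₂ β₃ p₂ p₃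
  · have := this h₃ h₂ (by linarith) (by linarith) (by linarith)
    rwa [mul_comm p₃] at this
  have a₁ := h₁.α_nonneg
  have a₂ := h₂.α_nonneg
  have a₃ := h₃.α_nonneg
  refine four_ninths_le (x := α₃) (y := α₁) a₃ a₁ h₃.α_le h₁.α_le
    (h₁.one_sub_ge a₃ le_rfl (by linarith)) ?_
  have := mul_le_div_max h₂ h₃ a₁ h c₂
  have e : (1 + α₁) / (1 + α₃ + α₁) = 1 - α₃ / (1 + α₁ + α₃) := by
    rw [add_right_comm]
    have : 1 + α₁ + α₃ ≠ 0 := by linarith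
    field_simp; ring
  linarith

theorem mul_le_half (h₁ : TwoPoint α₁ β₁ p₁) (h₂ : TwoPoint α₂ β₂ p₂) (c : 1 ≤ β₁ + β₂) :
    p₁ * p₂ ≤ 1 / 2 := by
  have := mul_le_mul h₁.p_mul_le h₂.p_mul_le
    (mul_nonneg h₂.p_nonneg (by linarith [h₂.β_nonneg])) zero_le_one
  have pp : 0 ≤ p₁ * p₂ := mul_nonneg h₁.p_nonneg h₂.p_nonneg
  have : p₁ * p₂ * (1 + (β₁ + β₂)) ≤ 1 := by
    nlinarith [mul_nonneg pp (mul_nonneg h₁.β_nonneg h₂.β_nonneg)]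
  nlinarith [mul_nonneg pp (sub_nonneg.2 c)]

theorem mul_mul_le_half (h₁ : TwoPoint α₁ β₁ p₁) (h₂ : TwoPoint α₂ β₂ p₂)
    (h₃ : TwoPoint α₃ β₃ p₃) (c : 1 ≤ β₁ + β₂ + β₃) : p₁ * p₂ * p₃ ≤ 1 / 2 := by
  have b₁ := h₁.β_nonneg
  have b₂ := h₂.β_nonneg
  have b₃ := h₃.β_nonneg
  have := mul_le_mul h₁.p_mul_le h₂.p_mul_le
    (mul_nonneg h₂.p_nonneg (by linarith)) zero_le_one
  have := mul_le_mul this h₃.p_mul_le (mul_nonneg h₃.p_nonneg (by linarith)) (by norm_num)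
  have pp : 0 ≤ p₁ * p₂ * p₃ := mul_nonneg (mul_nonneg h₁.p_nonneg h₂.p_nonneg) h₃.p_nonneg
  have : p₁ * p₂ * p₃ * (1 + (β₁ + β₂ + β₃)) ≤ 1 := by
    have : 0 ≤ p₁ * p₂ * p₃ * (β₁ * β₂ + β₁ * β₃ + β₂ * β₃ + β₁ * β₂ * β₃) := by positivity
    nlinarith
  nlinarith [mul_nonneg pp (sub_nonneg.2 c)]

theorem median_le_half (h₁ : TwoPoint α₁ β₁ p₁) (h₂ : TwoPoint α₂ β₂ p₂)
    (h₃ : TwoPoint α₃ β₃ p₃) (c₁ : 1 ≤ β₁) (c₂ : 1 ≤ β₂) (c₃ : 1 ≤ β₃) :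
    p₁ * p₂ + p₁ * p₃ + p₂ * p₃ - 2 * (p₁ * p₂ * p₃) ≤ 1 / 2 := by
  have q₁ := sub_nonneg.2 (h₁.p_le_half c₁)
  have q₂ := sub_nonneg.2 (h₂.p_le_half c₂)
  have q₃ := sub_nonneg.2 (h₃.p_le_half c₃)
  have := h₁.p_nonneg
  have := h₂.p_nonneg
  have := h₃.p_nonneg
  nlinarith [mul_nonneg (mul_nonneg q₁ q₂) q₃, mul_nonneg q₁ q₂, mul_nonneg q₁ q₃,
    mul_nonneg q₂ q₃]

theorem median_le (h₁ : TwoPoint α₁ β₁ p₁) (h₂ : TwoPoint α₂ β₂ p₂) (h₃ : TwoPoint α₃ β₃ p₃)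
    (c : β₁ < 1) (c₂ : 1 + α₃ ≤ β₁ + β₂) (c₃ : 1 + α₂ ≤ β₁ + β₃) :
    p₁ * p₂ + p₁ * p₃ + p₂ * p₃ - 2 * (p₁ * p₂ * p₃) ≤ 37 / 64 := by
  have a₂ := h₂.α_nonneg
  have a₃ := h₃.α_nonneg
  obtain ⟨u, rfl⟩ : ∃ u, β₁ = 1 - u := ⟨1 - β₁, by ring⟩
  have hu : 0 < u := by linarith
  have hu1 : u ≤ 1 := by linarith [h₁.β_nonneg]
  have hs : 0 < u + α₂ + α₃ := by linarith
  have e₁ : p₁ ≤ 1 / (2 - u) := by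
    rw [le_div_iff₀ (by linarith)]
    linarith [h₁.p_mul_le]
  have e₂ : p₂ ≤ α₂ / (u + α₂ + α₃) := h₂.p_le_div hs (by linarith)
  have e₃ : p₃ ≤ α₃ / (u + α₂ + α₃) := h₃.p_le_div hs (by linarith)
  set P₁ := 1 / (2 - u)
  set P₂ := α₂ / (u + α₂ + α₃)
  set P₃ := α₃ / (u + α₂ + α₃)
  have n₂ : P₂ ≤ 1 := div_le_one_of_le₀ (by linarith) hs.le
  have n₃ : P₃ ≤ 1 := div_le_one_of_le₀ (by linarith) hs.le
  have s₁ := h₁.p_nonneg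
  have s₂ := h₂.p_nonneg
  have s₃ := h₃.p_nonneg
  have t₁ := sub_nonneg.2 h₁.p_le
  have t₂ := sub_nonneg.2 h₂.p_le
  have t₃ := sub_nonneg.2 h₃.p_le
  have key : P₁ * P₂ + P₁ * P₃ + P₂ * P₃ - 2 * (P₁ * P₂ * P₃) ≤ 37 / 64 := by
    have : P₁ * P₂ + P₁ * P₃ + P₂ * P₃ - 2 * (P₁ * P₂ * P₃) =
        ((α₂ + α₃) * (u + α₂ + α₃) - u * α₂ * α₃) / ((2 - u) * (u + α₂ + α₃) ^ 2) := by
      have : 2 - u ≠ 0 := by linarith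
      simp only [P₁, P₂, P₃]
      field_simp
      ring
    rw [this, div_le_div_iff₀ (by have : 0 < 2 - u := by linarith
                                  positivity) (by norm_num)]
    linarith [ineq_median hu.le a₂ a₃ hu1 h₂.α_le h₃.α_le]
  have i₁ : p₁ * p₂ + p₁ * p₃ + p₂ * p₃ - 2 * (p₁ * p₂ * p₃) ≤
      P₁ * p₂ + P₁ * p₃ + p₂ * p₃ - 2 * (P₁ * p₂ * p₃) := by
    have : 0 ≤ p₂ + p₃ - 2 * (p₂ * p₃) := by nlinarith
    nlinarith [mul_le_mul_of_nonneg_right e₁ this]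
  have m₁ : P₁ ≤ 1 := by
    rw [div_le_one (by linarith)]
    linarith
  have m₀ : 0 ≤ P₁ := s₁.trans e₁
  have i₂ : P₁ * p₂ + P₁ * p₃ + p₂ * p₃ - 2 * (P₁ * p₂ * p₃) ≤
      P₁ * P₂ + P₁ * p₃ + P₂ * p₃ - 2 * (P₁ * P₂ * p₃) := by
    have : 0 ≤ P₁ + p₃ - 2 * (P₁ * p₃) := by nlinarith
    nlinarith [mul_le_mul_of_nonneg_right e₂ this]
  have i₃ : P₁ * P₂ + P₁ * p₃ + P₂ * p₃ - 2 * (P₁ * P₂ * p₃) ≤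
      P₁ * P₂ + P₁ * P₃ + P₂ * P₃ - 2 * (P₁ * P₂ * P₃) := by
    have : 0 ≤ P₁ + P₂ - 2 * (P₁ * P₂) := by nlinarith [s₂.trans e₂]
    nlinarith [mul_le_mul_of_nonneg_right e₃ this]
  linarith

/-- Three independent two-point variables with mean `1` sum to at least `4` with probability at
most `37 / 64`. -/
theorem prob_le (h₁ : TwoPoint α₁ β₁ p₁) (h₂ : TwoPoint α₂ β₂ p₂) (h₃ : TwoPoint α₃ β₃ p₃)
    (J : ℝ → ℝ) (hJ : ∀ t, J t = if 1 ≤ t then 1 else 0) :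
    (1 - p₁) * ((1 - p₂) * ((1 - p₃) * J (-α₁ - α₂ - α₃) + p₃ * J (-α₁ - α₂ + β₃)) +
      p₂ * ((1 - p₃) * J (-α₁ + β₂ - α₃) + p₃ * J (-α₁ + β₂ + β₃))) +
    p₁ * ((1 - p₂) * ((1 - p₃) * J (β₁ - α₂ - α₃) + p₃ * J (β₁ - α₂ + β₃)) +
      p₂ * ((1 - p₃) * J (β₁ + β₂ - α₃) + p₃ * J (β₁ + β₂ + β₃))) ≤ 37 / 64 := by
  have a₁ := h₁.α_nonneg
  have a₂ := h₂.α_nonneg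
  have a₃ := h₃.α_nonneg
  have b₁ := h₁.β_nonneg
  have b₂ := h₂.β_nonneg
  have b₃ := h₃.β_nonneg
  have s₁ := h₁.p_nonneg
  have s₂ := h₂.p_nonneg
  have s₃ := h₃.p_nonneg
  have t₁ := sub_nonneg.2 h₁.p_le
  have t₂ := sub_nonneg.2 h₂.p_le
  have t₃ := sub_nonneg.2 h₃.p_le
  have J0 : ∀ t, ¬ 1 ≤ t → J t = 0 := fun t ht => by rw [hJ, if_neg ht]
  have J1 : ∀ t, J t ≤ 1 := fun t => by rw [hJ]; split_ifs <;> norm_num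
  have key : ∀ c t : ℝ, 0 ≤ c → c * J t ≤ c := fun c t hc => mul_le_of_le_one_right hc (J1 t)
  rw [J0 (-α₁ - α₂ - α₃) (by linarith)]
  have k001 := key _ (-α₁ - α₂ + β₃) (mul_nonneg (mul_nonneg t₁ t₂) s₃)
  have k010 := key _ (-α₁ + β₂ - α₃) (mul_nonneg (mul_nonneg t₁ s₂) t₃)
  have k011 := key _ (-α₁ + β₂ + β₃) (mul_nonneg (mul_nonneg t₁ s₂) s₃)
  have k100 := key _ (β₁ - α₂ - α₃) (mul_nonneg (mul_nonneg s₁ t₂) t₃)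
  have k101 := key _ (β₁ - α₂ + β₃) (mul_nonneg (mul_nonneg s₁ t₂) s₃)
  have k110 := key _ (β₁ + β₂ - α₃) (mul_nonneg (mul_nonneg s₁ s₂) t₃)
  have k111 := key _ (β₁ + β₂ + β₃) (mul_nonneg (mul_nonneg s₁ s₂) s₃)
  have n001 := mul_nonneg (mul_nonneg t₁ t₂) s₃
  have n010 := mul_nonneg (mul_nonneg t₁ s₂) t₃
  have n011 := mul_nonneg (mul_nonneg t₁ s₂) s₃
  have n100 := mul_nonneg (mul_nonneg s₁ t₂) t₃
  have n101 := mul_nonneg (mul_nonneg s₁ t₂) s₃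
  have n110 := mul_nonneg (mul_nonneg s₁ s₂) t₃
  have n111 := mul_nonneg (mul_nonneg s₁ s₂) s₃
  clear J1 key
  by_cases c1 : 1 ≤ β₁ - α₂ - α₃ <;> by_cases c2 : 1 ≤ -α₁ + β₂ - α₃ <;>
    by_cases c3 : 1 ≤ -α₁ - α₂ + β₃
  · have := h₁.three_singles h₂ h₃ (by linarith) (by linarith) (by linarith)
    linarith
  · rw [J0 _ c3]
    have := h₁.two_singles h₂ (by linarith) (by linarith)
    linarith
  · rw [J0 _ c2]
    have := h₁.two_singles h₃ (by linarith) (by linarith)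
    linarith
  · rw [J0 _ c2, J0 _ c3]
    by_cases d : 1 ≤ -α₁ + β₂ + β₃
    · have := h₁.single_double h₂ h₃ (by linarith) (by linarith)
      linarith
    · rw [J0 _ d]
      have := h₁.p_le_half (by linarith)
      linarith
  · rw [J0 _ c1]
    have := h₂.two_singles h₃ (by linarith) (by linarith)
    linarith
  · rw [J0 _ c1, J0 _ c3]
    by_cases d : 1 ≤ β₁ - α₂ + β₃
    · have := h₂.single_double h₁ h₃ (by linarith) (by linarith)
      linarith
    · rw [J0 _ d]
      have := h₂.p_le_half (by linarith)
      linarith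
  · rw [J0 _ c1, J0 _ c2]
    by_cases d : 1 ≤ β₁ + β₂ - α₃
    · have := h₃.single_double h₁ h₂ (by linarith) (by linarith)
      linarith
    · rw [J0 _ d]
      have := h₃.p_le_half (by linarith)
      linarith
  · rw [J0 _ c1, J0 _ c2, J0 _ c3]
    by_cases d1 : 1 ≤ -α₁ + β₂ + β₃ <;> by_cases d2 : 1 ≤ β₁ - α₂ + β₃ <;>
      by_cases d3 : 1 ≤ β₁ + β₂ - α₃
    · have : p₁ * p₂ + p₁ * p₃ + p₂ * p₃ - 2 * (p₁ * p₂ * p₃) ≤ 37 / 64 := by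
        rcases lt_or_ge β₁ 1 with e | e₁
        · exact h₁.median_le h₂ h₃ e (by linarith) (by linarith)
        rcases lt_or_ge β₂ 1 with e | e₂
        · have := h₂.median_le h₁ h₃ e (by linarith) (by linarith)
          linarith
        rcases lt_or_ge β₃ 1 with e | e₃
        · have := h₃.median_le h₁ h₂ e (by linarith) (by linarith)
          linarith
        linarith [h₁.median_le_half h₂ h₃ e₁ e₂ e₃]
      linarith
    · rw [J0 _ d3]
      rcases lt_or_ge β₃ 1 with e | e
      · have := h₃.median_le h₁ h₂ e (by linarith) (by linarith)
        linarith [mul_nonneg (mul_nonneg s₁ s₂) t₃]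
      · have := h₃.p_le_half e
        linarith [mul_nonneg s₃ (mul_nonneg t₁ t₂)]
    · rw [J0 _ d2]
      rcases lt_or_ge β₂ 1 with e | e
      · have := h₂.median_le h₁ h₃ e (by linarith) (by linarith)
        linarith [mul_nonneg (mul_nonneg s₁ s₃) t₂]
      · have := h₂.p_le_half e
        linarith [mul_nonneg s₂ (mul_nonneg t₁ t₃)]
    · rw [J0 _ d2, J0 _ d3]
      have := h₂.mul_le_half h₃ (by linarith)
      linarith
    · rw [J0 _ d1]
      rcases lt_or_ge β₁ 1 with e | e
      · have := h₁.median_le h₂ h₃ e (by linarith) (by linarith)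
        linarith [mul_nonneg (mul_nonneg s₂ s₃) t₁]
      · have := h₁.p_le_half e
        linarith [mul_nonneg s₁ (mul_nonneg t₂ t₃)]
    · rw [J0 _ d1, J0 _ d3]
      have := h₁.mul_le_half h₃ (by linarith)
      linarith
    · rw [J0 _ d1, J0 _ d2]
      have := h₁.mul_le_half h₂ (by linarith)
      linarith
    · rw [J0 _ d1, J0 _ d2, J0 _ d3]
      by_cases e : 1 ≤ β₁ + β₂ + β₃
      · have := h₁.mul_mul_le_half h₂ h₃ e
        linarith
      · rw [J0 _ e]
        norm_num

end TwoPoint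

theorem sum_le_of_twoPoint {ι : Type*} [Fintype ι] {w f : ι → ℝ} {C : ℝ} (hw : ∀ i, 0 ≤ w i)
    (hsum : ∑ i, w i = Fintype.card ι)
    (h : ∀ i j p, TwoPoint (1 - w i) (w j - 1) p → (1 - p) * f i + p * f j ≤ C) :
    ∑ i, f i ≤ C * Fintype.card ι := by
  classical
  set L := univ.filter fun i => w i < 1
  set U := univ.filter fun i => ¬ w i < 1
  have split : ∀ g : ι → ℝ, ∑ i, g i = ∑ i ∈ L, g i + ∑ i ∈ U, g i := fun g =>
    (sum_filter_add_sum_filter_not _ _ _).symm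
  have hone : ∑ _i : ι, (1 : ℝ) = Fintype.card ι := by simp
  set D := ∑ i ∈ L, (1 - w i)
  have hD : ∑ i ∈ U, (w i - 1) = D := by
    have : ∑ i, (w i - 1) = 0 := by rw [sum_sub_distrib, hsum, hone, sub_self]
    rw [split] at this
    have e : D = - ∑ i ∈ L, (w i - 1) := by
      rw [← sum_neg_distrib]
      exact sum_congr rfl fun i _ => by ring
    linarith
  have hL : ∀ i ∈ L, 0 < 1 - w i := fun i hi => by
    have := (mem_filter.1 hi).2
    linarith
  have hU : ∀ i ∈ U, 0 ≤ w i - 1 := fun i hi => by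
    have := (mem_filter.1 hi).2
    linarith
  have pair : ∀ i ∈ L, ∀ j ∈ U,
      (w j - 1) * f i + (1 - w i) * f j ≤ C * ((1 - w i) + (w j - 1)) := by
    intro i hi j hj
    have h1 := hL i hi
    have h2 := hU j hj
    have hs : 0 < (1 - w i) + (w j - 1) := by linarith
    have := h i j ((1 - w i) / ((1 - w i) + (w j - 1))) ⟨h1.le, by linarith [hw i], h2,
      div_nonneg h1.le hs.le, div_le_one_of_le₀ (by linarith) hs.le, by field_simp; ring⟩
    have e : (1 - (1 - w i) / ((1 - w i) + (w j - 1))) * f i +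
        (1 - w i) / ((1 - w i) + (w j - 1)) * f j =
        ((w j - 1) * f i + (1 - w i) * f j) / ((1 - w i) + (w j - 1)) := by
      field_simp; ring
    rwa [e, div_le_iff₀ hs] at this
  have total : D * ∑ i, f i ≤ D * (C * Fintype.card ι) := by
    have := sum_le_sum fun i hi => sum_le_sum fun j hj => pair i hi j hj
    have e1 : ∑ i ∈ L, ∑ j ∈ U, ((w j - 1) * f i + (1 - w i) * f j) = D * ∑ i, f i := by
      rw [split]
      simp only [sum_add_distrib]
      simp only [← sum_mul, ← mul_sum, hD]
      ring
    have e2 : ∑ i ∈ L, ∑ j ∈ U, C * ((1 - w i) + (w j - 1)) = D * (C * Fintype.card ι) := by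
      rw [← hone, split]
      simp only [← mul_sum, sum_add_distrib, hD, sum_const, nsmul_eq_mul]
      change C * (_ * D + _) = _
      ring
    linarith
  have hD0 : 0 ≤ D := sum_nonneg fun i hi => (hL i hi).le
  rcases hD0.eq_or_lt with h0 | h0
  · have hL0 : ∀ i ∈ L, (1 - w i) = 0 :=
      (sum_eq_zero_iff_of_nonneg fun i hi => (hL i hi).le).1 h0.symm
    have hU0 : ∀ i ∈ U, (w i - 1) = 0 := (sum_eq_zero_iff_of_nonneg hU).1 (hD.trans h0.symm)
    have : ∀ i, f i ≤ C := by
      intro i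
      have hi : w i = 1 := by
        by_cases hi : w i < 1
        · linarith [hL0 i (by simp [L, hi])]
        · linarith [hU0 i (by simp [U, le_of_not_gt hi])]
      simpa using h i i 0 ⟨by simp [hi], by simp [hi], by simp [hi], le_rfl, zero_le_one, by
        simp [hi]⟩
    calc ∑ i, f i ≤ ∑ _i : ι, C := sum_le_sum fun i _ => this i
      _ = _ := by simp [mul_comm]
  · exact le_of_mul_le_mul_left total h0

/-- Among the triples of indices of nonnegative weights with mean `1`, at most the fraction
`37 / 64 = 1 - (3 / 4) ^ 3` has weight at least `4`. -/
theorem sum_heavy_triples_le {ι : Type*} [Fintype ι] {w : ι → ℝ} (hw : ∀ i, 0 ≤ w i)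
    (hsum : ∑ i, w i = Fintype.card ι) :
    ∑ i, ∑ j, ∑ k, (if 4 ≤ w i + w j + w k then 1 else 0 : ℝ) ≤
      37 / 64 * (Fintype.card ι : ℝ) ^ 3 := by
  set J : ℝ → ℝ := fun t => if 1 ≤ t then 1 else 0
  have hJ : ∀ i j k, (if 4 ≤ w i + w j + w k then 1 else 0 : ℝ) = J (w i + w j + w k - 3) := by
    intro i j k
    simp only [J]
    congr 1
    exact propext ⟨fun h => by linarith, fun h => by linarith⟩
  simp only [hJ]
  suffices h : ∑ i, ∑ j, ∑ k, J (w i + w j + w k - 3) ≤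
      37 / 64 * Fintype.card ι * Fintype.card ι * Fintype.card ι by
    linarith
  refine sum_le_of_twoPoint hw hsum fun i i' p h₁ => ?_
  suffices h : ∑ j, ∑ k, ((1 - p) * J (w i + w j + w k - 3) + p * J (w i' + w j + w k - 3)) ≤
      37 / 64 * Fintype.card ι * Fintype.card ι by
    simpa only [sum_add_distrib, ← mul_sum] using h
  refine sum_le_of_twoPoint hw hsum fun j j' q h₂ => ?_
  suffices h : ∑ k, ((1 - q) * ((1 - p) * J (w i + w j + w k - 3) + p * J (w i' + w j + w k - 3))
      + q * ((1 - p) * J (w i + w j' + w k - 3) + p * J (w i' + w j' + w k - 3))) ≤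
      37 / 64 * Fintype.card ι by
    simpa only [sum_add_distrib, ← mul_sum] using h
  refine sum_le_of_twoPoint hw hsum fun k k' r h₃ => ?_
  have := h₁.prob_le h₂ h₃ J fun t => rfl
  have e : ∀ a b c, J (w a + w b + w c - 3) = J ((w a - 1) + (w b - 1) + (w c - 1)) :=
    fun a b c => by congr 1; ring
  have n : ∀ a, -(1 - w a) = w a - 1 := fun a => by ring
  have s : ∀ t a, t - (1 - w a) = t + (w a - 1) := fun t a => by ring
  simp only [n, s, ← e] at this
  linarith

/-- A `4`-uniform system of ordered edges of large minimum degree has a fractional perfect matching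
with few edges in its support. -/
theorem exists_fractional_perfect_matching {ι : Type*} [Fintype ι] [Nonempty ι] [DecidableEq ι]
    (Q : ι → ι → ι → ι → Prop) [∀ i j k l, Decidable (Q i j k l)]
    (hQ : ∀ i, 37 / 64 * (Fintype.card ι : ℝ) ^ 3 <
      ∑ j, ∑ k, ∑ l, (if Q i j k l then 1 else 0 : ℝ)) :
    ∃ (r : ℕ) (e : Fin r → Fin 4 → ι) (x : Fin r → ℝ), r ≤ Fintype.card ι + 1 ∧
      (∀ a, 0 ≤ x a) ∧ (∀ a, Q (e a 0) (e a 1) (e a 2) (e a 3)) ∧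
      ∀ i, ∑ a, x a * (#{j | e a j = i} : ℝ) = 1 := by
  classical
  set b : ℝ := (Fintype.card ι : ℝ)
  have hb : 0 < b := by simp only [b]; exact_mod_cast Fintype.card_pos
  set v : (Fin 4 → ι) → ι → ℝ := fun e => ∑ j, Pi.single (e j) 1
  have hv : ∀ e i, v e i = (#{j | e j = i} : ℝ) := by
    intro e i
    simp only [v, Finset.sum_apply, Pi.single_apply, card_filter, Nat.cast_sum, Nat.cast_ite,
      Nat.cast_one, Nat.cast_zero, eq_comm]
  set T : Set (ι → ℝ) := Set.image v {e | Q (e 0) (e 1) (e 2) (e 3)}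
  have hmem : (fun _ => 4 / b : ι → ℝ) ∈ convexHull ℝ T := by
    by_contra hnot
    have hfin : T.Finite := Set.toFinite _
    obtain ⟨f, u, hu, hT⟩ := geometric_hahn_banach_point_closed (convex_convexHull ℝ T)
      (hfin.isClosed_convexHull ℝ) hnot
    set c : ι → ℝ := fun i => f (Pi.single i 1)
    have hf : ∀ y : ι → ℝ, f y = ∑ i, y i * c i := by
      intro y
      conv_lhs => rw [pi_eq_sum_univ' y]
      rw [map_sum]
      refine sum_congr rfl fun i _ => ?_
      rw [map_smul, smul_eq_mul]
    obtain ⟨i₀, -, hmin⟩ := exists_min_image univ c univ_nonempty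
    set w : ι → ℝ := fun i => c i - c i₀
    have hw : ∀ i, 0 ≤ w i := fun i => sub_nonneg.2 (hmin i (mem_univ i))
    have edge : ∀ j k l, Q i₀ j k l → 4 / b * ∑ i, w i < w j + w k + w l := by
      intro j k l h
      have h1 := hT _ (subset_convexHull ℝ T ⟨![i₀, j, k, l], by simpa using h, rfl⟩)
      have h2 : f (v ![i₀, j, k, l]) = c i₀ + c j + c k + c l := by
        simp only [v, Fin.sum_univ_four, map_add]
        rfl
      have h3 : 4 / b * ∑ i, w i = f (fun _ => 4 / b) - 4 * c i₀ := by
        rw [hf, ← mul_sum]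
        simp only [w, sum_sub_distrib, sum_const, card_univ, nsmul_eq_mul]
        change 4 / b * (_ - b * _) = _
        field_simp
      simp only [w] at h3 ⊢
      linarith
    have hW0 : 0 ≤ ∑ i, w i := sum_nonneg fun i _ => hw i
    have hcount := hQ i₀
    rcases hW0.eq_or_lt with h0 | h0
    · have hz : ∀ i, w i = 0 := fun i =>
        (sum_eq_zero_iff_of_nonneg fun i _ => hw i).1 h0.symm i (mem_univ i)
      have : ∑ j, ∑ k, ∑ l, (if Q i₀ j k l then 1 else 0 : ℝ) = 0 := by
        refine sum_eq_zero fun j _ => sum_eq_zero fun k _ => sum_eq_zero fun l _ => ?_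
        rw [if_neg]
        intro h
        have := edge j k l h
        simp [hz] at this
      have : 0 ≤ 37 / 64 * b ^ 3 := by positivity
      linarith
    · set W := ∑ i, w i
      have := sum_heavy_triples_le (w := fun i => b / W * w i)
        (fun i => mul_nonneg (div_nonneg hb.le h0.le) (hw i))
        (by rw [← mul_sum]; change b / W * W = b; field_simp)
      refine absurd (hcount.trans_le (le_trans ?_ this)) (lt_irrefl _)
      refine sum_le_sum fun j _ => sum_le_sum fun k _ => sum_le_sum fun l _ => ?_
      by_cases h : Q i₀ j k l
      · rw [if_pos h, if_pos]
        have h1 := (edge j k l h).le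
        have h2 : 4 = b / W * (4 / b * W) := by field_simp
        rw [← mul_add, ← mul_add, h2]
        exact mul_le_mul_of_nonneg_left h1 (by positivity)
      · rw [if_neg h]
        split_ifs <;> norm_num
  obtain ⟨κ, _, z, x, hz, haff, hx, -, hsum⟩ := eq_pos_convex_span_of_mem_convexHull hmem
  have hcard : Fintype.card κ ≤ Fintype.card ι + 1 := by
    have := haff.card_le_finrank_succ
    refine this.trans (Nat.succ_le_succ ?_)
    exact (Submodule.finrank_le _).trans (by simp)
  choose e he hez using fun a => hz (Set.mem_range_self a)
  let g := (Fintype.equivFin κ).symm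
  refine ⟨Fintype.card κ, fun a => e (g a), fun a => b / 4 * x (g a), hcard,
    fun a => by have := (hx (g a)).le; positivity, fun a => he (g a), fun i => ?_⟩
  have h1 := congrFun hsum i
  simp only [Finset.sum_apply, Pi.smul_apply, smul_eq_mul] at h1
  rw [g.sum_comp fun a => b / 4 * x a * (#{j | e a j = i} : ℝ)]
  simp only [← hv, hez, mul_assoc, ← mul_sum, h1]
  field_simp

/-- `φ` is a homomorphism from the complete `4`-partite `4`-graph with parts of size `m` to the
ordered `4`-graph `R`. -/
def BlowupHom {V : Type*} (R : V → V → V → V → Prop) {m : ℕ} (φ : Fin 4 × Fin m → V) : Prop :=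
  ∀ i j k l, R (φ (0, i)) (φ (1, j)) (φ (2, k)) (φ (3, l))

theorem pow_density_le_sum_prod {α B C D : Type*} [Fintype α] [Fintype B] [Fintype C] [Fintype D]
    {s : α → B → C → D → ℝ} (hs : ∀ a b c d, 0 ≤ s a b c d) {δ : ℝ} (hδ : 0 ≤ δ) (m : ℕ)
    (h : δ * (Fintype.card α * (Fintype.card B * Fintype.card C * Fintype.card D)) ≤
      ∑ a, ∑ b, ∑ c, ∑ d, s a b c d) :
    δ ^ m * ((Fintype.card α : ℝ) ^ m * (Fintype.card B * Fintype.card C * Fintype.card D)) ≤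
      ∑ b, ∑ c, ∑ d, ∑ f : Fin m → α, ∏ i, s (f i) b c d := by
  have e1 : ∑ a, ∑ b, ∑ c, ∑ d, s a b c d = ∑ y : B × C × D, ∑ a, s a y.1 y.2.1 y.2.2 := by
    simp only [sum_comm (s := (univ : Finset (B × C × D))), Fintype.sum_prod_type]
  have e2 : ∑ b, ∑ c, ∑ d, ∑ f : Fin m → α, ∏ i, s (f i) b c d =
      ∑ y : B × C × D, (∑ a, s a y.1 y.2.1 y.2.2) ^ m := by
    simp only [Fintype.sum_pow, Fintype.sum_prod_type]
  have e3 : (Fintype.card B * Fintype.card C * Fintype.card D : ℝ) =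
      Fintype.card (B × C × D) := by
    simp only [Fintype.card_prod]
    push_cast
    ring
  rw [e1, e3] at h
  rw [e2, e3]
  set Y := B × C × D
  set F : Y → ℝ := fun y => ∑ a, s a y.1 y.2.1 y.2.2
  have hF : ∀ y, 0 ≤ F y := fun y => sum_nonneg fun a _ => hs _ _ _ _
  rcases m with _ | m
  · simp
  · rcases Nat.eq_zero_or_pos (Fintype.card Y) with h0 | h0
    · rw [h0]
      simpa using sum_nonneg fun y _ => pow_nonneg (hF y) (m + 1)
    · have hY : (0 : ℝ) < Fintype.card Y := by exact_mod_cast h0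
      have h1 := pow_sum_div_card_le_sum_pow (s := univ) (f := F) (fun y _ => hF y) m
      refine le_trans ?_ h1
      rw [le_div_iff₀ (by simpa using pow_pos hY m), card_univ]
      calc _ = (δ * (Fintype.card α * Fintype.card Y)) ^ (m + 1) := by ring
        _ ≤ _ := pow_le_pow_left₀ (by positivity) h _

theorem prod_prop_ite {ι : Type*} [Fintype ι] (p : ι → Prop) [DecidablePred p]
    [Decidable (∀ i, p i)] :
    ∏ i, (if p i then 1 else 0 : ℝ) = if ∀ i, p i then 1 else 0 := by
  simp [prod_ite_zero]

open Classical in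
/-- An ordered `4`-graph of positive density contains a positive proportion of the possible
homomorphic copies of the complete `4`-partite `4`-graph. -/
theorem card_blowupHom_ge {α : Type*} [Fintype α] (G : α → α → α → α → Prop) {δ : ℝ} (hδ : 0 ≤ δ)
    (m : ℕ) (h : δ * (Fintype.card α : ℝ) ^ 4 ≤
      ∑ a, ∑ b, ∑ c, ∑ d, (if G a b c d then 1 else 0 : ℝ)) :
    δ ^ m ^ 4 * (Fintype.card α : ℝ) ^ (4 * m) ≤
      (#{φ : Fin 4 × Fin m → α | BlowupHom G φ} : ℝ) := by
  have h1 := pow_density_le_sum_prod (s := fun a b c d => (if G a b c d then 1 else 0 : ℝ))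
    (fun a b c d => by split_ifs <;> norm_num) hδ m
    (le_trans (le_of_eq (by ring)) h)
  simp only [prod_prop_ite] at h1
  have h2 := pow_density_le_sum_prod
    (s := fun b c d (f : Fin m → α) => (if ∀ i, G (f i) b c d then 1 else 0 : ℝ))
    (fun a b c d => by split_ifs <;> norm_num) (pow_nonneg hδ m) m
    (le_trans (le_of_eq (by
      simp only [Fintype.card_pi_const]
      push_cast
      ring)) h1)
  simp only [prod_prop_ite] at h2
  have h3 := pow_density_le_sum_prod
    (s := fun c d (f g : Fin m → α) => (if ∀ j, ∀ i, G (f i) (g j) c d then 1 else 0 : ℝ))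
    (fun a b c d => by split_ifs <;> norm_num) (pow_nonneg (pow_nonneg hδ m) m) m
    (le_trans (le_of_eq (by
      simp only [Fintype.card_pi_const]
      push_cast
      ring)) h2)
  simp only [prod_prop_ite] at h3
  have h4 := pow_density_le_sum_prod
    (s := fun d (f g e : Fin m → α) =>
      (if ∀ k, ∀ j, ∀ i, G (f i) (g j) (e k) d then 1 else 0 : ℝ))
    (fun a b c d => by split_ifs <;> norm_num)
    (pow_nonneg (pow_nonneg (pow_nonneg hδ m) m) m) m
    (le_trans (le_of_eq (by
      simp only [Fintype.card_pi_const]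
      push_cast
      ring)) h3)
  simp only [prod_prop_ite] at h4
  have e : (∑ f : Fin m → α, ∑ g : Fin m → α, ∑ e : Fin m → α, ∑ d : Fin m → α,
      (if ∀ l, ∀ k, ∀ j, ∀ i, G (f i) (g j) (e k) (d l) then 1 else 0 : ℝ)) =
      (#{q : (Fin m → α) × (Fin m → α) × (Fin m → α) × (Fin m → α) |
        ∀ l, ∀ k, ∀ j, ∀ i, G (q.1 i) (q.2.1 j) (q.2.2.1 k) (q.2.2.2 l)} : ℝ) := by
    rw [card_filter]
    push_cast
    simp only [Fintype.sum_prod_type]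
  rw [e] at h4
  calc δ ^ m ^ 4 * (Fintype.card α : ℝ) ^ (4 * m) = _ := by
        simp only [Fintype.card_pi_const]
        push_cast
        ring
    _ ≤ _ := h4
    _ ≤ _ := by
      refine Nat.cast_le.2 (card_le_card_of_injOn
        (fun q p => (![q.1, q.2.1, q.2.2.1, q.2.2.2] : Fin 4 → Fin m → α) p.1 p.2) ?_ ?_)
      · intro q hq
        simp only [coe_filter, mem_univ, true_and, Set.mem_ofPred_eq] at hq ⊢
        exact fun i j k l => hq l k j i
      · intro q _ q' _ h
        ext i
        · exact congrFun h (0, i)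
        · exact congrFun h (1, i)
        · exact congrFun h (2, i)
        · exact congrFun h (3, i)

open Classical in
/-- Few functions identify two given coordinates. -/
theorem card_collision_le {ι α : Type*} [Fintype ι] [Fintype α] {i j : ι} (hij : i ≠ j) :
    #{φ : ι → α | φ i = φ j} * Fintype.card α ≤ Fintype.card α ^ Fintype.card ι := by
  rw [← Fintype.card_fun, ← card_univ (α := α), ← card_product, ← card_univ]
  refine card_le_card_of_injOn (fun q => Function.update q.1 i q.2) (by simp) ?_
  rintro ⟨φ, a⟩ hφ ⟨ψ, b⟩ hψ h
  simp only [coe_product, coe_filter, mem_univ, true_and, coe_univ, Set.mem_prod,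
    Set.mem_ofPred_eq, Set.mem_univ, and_true] at hφ hψ h
  have hk : ∀ k, k ≠ i → φ k = ψ k := fun k hk => by
    simpa [hk] using congrFun h k
  have ha : a = b := by simpa using congrFun h i
  refine Prod.ext ?_ ha
  funext k
  by_cases hki : k = i
  · change φ k = ψ k
    rw [hki, hφ, hψ, hk j hij.symm]
  · exact hk k hki

open Classical in
theorem card_not_injOn_le {ι α : Type*} [Fintype ι] [Fintype α] (J : Finset ι) :
    #{φ : ι → α | ¬ Set.InjOn φ J} * Fintype.card α ≤
      #J ^ 2 * Fintype.card α ^ Fintype.card ι := by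
  have : ({φ : ι → α | ¬ Set.InjOn φ J} : Finset _) ⊆
      J.offDiag.biUnion fun p => {φ : ι → α | φ p.1 = φ p.2} := by
    intro φ hφ
    simp only [mem_filter, mem_univ, true_and, Set.InjOn, not_forall] at hφ
    obtain ⟨i, hi, j, hj, h, hne⟩ := hφ
    simp only [mem_biUnion, mem_offDiag, mem_filter, mem_univ, true_and]
    exact ⟨(i, j), ⟨hi, hj, hne⟩, h⟩
  calc _ ≤ (∑ p ∈ J.offDiag, #{φ : ι → α | φ p.1 = φ p.2}) * Fintype.card α :=
        Nat.mul_le_mul_right _ ((card_le_card this).trans card_biUnion_le)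
    _ = ∑ p ∈ J.offDiag, #{φ : ι → α | φ p.1 = φ p.2} * Fintype.card α := sum_mul _ _ _
    _ ≤ ∑ p ∈ J.offDiag, Fintype.card α ^ Fintype.card ι :=
        sum_le_sum fun p hp => card_collision_le (mem_offDiag.1 hp).2.2
    _ ≤ _ := by
      rw [sum_const, smul_eq_mul]
      refine Nat.mul_le_mul_right _ ?_
      rw [offDiag_card, sq]
      exact Nat.sub_le _ _

/-- An ordered `4`-graph of positive density on many vertices contains a copy of the complete
`4`-partite `4`-graph. -/
theorem exists_injective_blowupHom {α : Type*} [Fintype α] (G : α → α → α → α → Prop)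
    [∀ a b c d, Decidable (G a b c d)] {δ : ℝ} (hδ : 0 ≤ δ) (m : ℕ)
    (hα : (4 * m : ℝ) ^ 2 < δ ^ m ^ 4 * Fintype.card α)
    (h : δ * (Fintype.card α : ℝ) ^ 4 ≤
      ∑ a, ∑ b, ∑ c, ∑ d, (if G a b c d then 1 else 0 : ℝ)) :
    ∃ φ : Fin 4 × Fin m → α, Function.Injective φ ∧ BlowupHom G φ := by
  classical
  by_contra! hno
  have h1 := card_blowupHom_ge G hδ m (by convert h)
  have hpos : (0 : ℝ) < Fintype.card α := by
    by_contra h0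
    have : (Fintype.card α : ℝ) = 0 := le_antisymm (not_lt.1 h0) (Nat.cast_nonneg _)
    rw [this, mul_zero] at hα
    exact absurd hα (not_lt.2 (by positivity))
  have h2 := card_not_injOn_le (α := α) (univ : Finset (Fin 4 × Fin m))
  have h3 : #{φ : Fin 4 × Fin m → α | BlowupHom G φ} * Fintype.card α ≤
      #(univ : Finset (Fin 4 × Fin m)) ^ 2 *
        Fintype.card α ^ Fintype.card (Fin 4 × Fin m) := by
    refine le_trans (Nat.mul_le_mul_right _ (card_le_card fun φ hφ => ?_)) h2
    simp only [mem_filter, mem_univ, true_and, coe_univ, Set.injOn_univ] at hφ ⊢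
    exact fun hi => hno φ hi hφ
  have hJ : Fintype.card (Fin 4 × Fin m) = 4 * m := by simp
  rw [card_univ, hJ] at h3
  have h4 : (#{φ : Fin 4 × Fin m → α | BlowupHom G φ} : ℝ) * Fintype.card α ≤
      (4 * m) ^ 2 * (Fintype.card α : ℝ) ^ (4 * m) := by
    have h7 := (Nat.cast_le (α := ℝ)).2 h3
    simp only [Nat.cast_mul, Nat.cast_pow] at h7
    simpa only [Nat.cast_ofNat] using h7
  have h5 := mul_le_mul_of_nonneg_right h1 hpos.le
  have h6 : 0 < (Fintype.card α : ℝ) ^ (4 * m) := pow_pos hpos _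
  nlinarith [mul_lt_mul_of_pos_right hα h6]

/-- There are `t` vertex-disjoint copies in `R` of the complete `4`-partite `4`-graph with parts
of size `M`. -/
def HasTiling {V : Type*} (R : V → V → V → V → Prop) (M t : ℕ) : Prop :=
  ∃ φ : Fin t → Fin 4 × Fin M → V,
    Function.Injective (fun q : Fin t × (Fin 4 × Fin M) => φ q.1 q.2) ∧ ∀ s, BlowupHom R (φ s)

theorem HasTiling.of_fintype {V τ : Type*} [Fintype τ] {R : V → V → V → V → Prop} {M : ℕ}
    (φ : τ → Fin 4 × Fin M → V)
    (hφ : Function.Injective (fun q : τ × (Fin 4 × Fin M) => φ q.1 q.2))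
    (hR : ∀ s, BlowupHom R (φ s)) : HasTiling R M (Fintype.card τ) := by
  refine ⟨fun s => φ ((Fintype.equivFin τ).symm s), ?_, fun s => hR _⟩
  rintro ⟨s, p⟩ ⟨s', p'⟩ h
  have := @hφ ((Fintype.equivFin τ).symm s, p) ((Fintype.equivFin τ).symm s', p') h
  simpa using this

open Classical in
/-- Every vertex has degree at least `κ * |V| ^ 3` in the ordered `4`-graph `R`. -/
def MinDegreeGE {V : Type*} [Fintype V] (R : V → V → V → V → Prop) (κ : ℝ) : Prop :=
  ∀ a, κ * (Fintype.card V : ℝ) ^ 3 ≤ ∑ b, ∑ c, ∑ d, (if R a b c d then 1 else 0 : ℝ)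

/-- Deleting few positions from each of the four coordinates destroys few edges. -/
theorem sum_ite_and_notMem_ge {α : Type*} [Fintype α] [DecidableEq α] (R : α → α → α → α → Prop)
    [∀ a b c d, Decidable (R a b c d)]
    (U : Fin 4 → Finset α) {w : ℝ} (hU : ∀ c, (#(U c) : ℝ) ≤ w) :
    (∑ a, ∑ b, ∑ c, ∑ d, (if R a b c d then 1 else 0 : ℝ)) - 4 * w * (Fintype.card α : ℝ) ^ 3 ≤
      ∑ a, ∑ b, ∑ c, ∑ d, (if R a b c d ∧ a ∉ U 0 ∧ b ∉ U 1 ∧ c ∉ U 2 ∧ d ∉ U 3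
        then 1 else 0 : ℝ) := by
  have key : ∀ a b c d, (if R a b c d then 1 else 0 : ℝ) ≤
      (if R a b c d ∧ a ∉ U 0 ∧ b ∉ U 1 ∧ c ∉ U 2 ∧ d ∉ U 3 then 1 else 0 : ℝ) +
      ((if a ∈ U 0 then 1 else 0) + (if b ∈ U 1 then 1 else 0) + (if c ∈ U 2 then 1 else 0) +
        (if d ∈ U 3 then 1 else 0)) := by
    intro a b c d
    by_cases h0 : a ∈ U 0 <;> by_cases h1 : b ∈ U 1 <;> by_cases h2 : c ∈ U 2 <;>
      by_cases h3 : d ∈ U 3 <;> by_cases h : R a b c d <;> simp [*] <;> norm_num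
  have h1 : ∑ a, ∑ b, ∑ c, ∑ d, (if R a b c d then 1 else 0 : ℝ) ≤ _ :=
    sum_le_sum fun a _ => sum_le_sum fun b _ => sum_le_sum fun c _ => sum_le_sum fun d _ =>
      key a b c d
  simp only [sum_add_distrib, sum_const, card_univ, sum_ite_mem, univ_inter, nsmul_eq_mul,
    mul_one] at h1
  have hn : (0 : ℝ) ≤ (Fintype.card α : ℝ) := Nat.cast_nonneg _
  have h2 : ∀ c, (Fintype.card α : ℝ) ^ 3 * #(U c) ≤ (Fintype.card α : ℝ) ^ 3 * w := fun c =>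
    mul_le_mul_of_nonneg_left (hU c) (by positivity)
  simp only [← mul_sum, sum_const, sum_ite_mem, univ_inter, nsmul_eq_mul,
    mul_one] at h1
  nlinarith [h2 0, h2 1, h2 2, h2 3]

/-- Greedy embedding: given dense quadruples of blocks, such that no block is used too often, one
can find vertex-disjoint complete `4`-partite `4`-graphs respecting them. -/
theorem exists_disjoint_blowupHom {V ι J : Type*} [Fintype J] [DecidableEq ι]
    {M M' : ℕ} (R : V → V → V → V → Prop) [∀ a b c d, Decidable (R a b c d)]
    (β : ι → Fin M → V) (f : J → Fin 4 → ι) {δ : ℝ} (hδ : 0 ≤ δ) (W : ℕ)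
    (hM : (4 * M' : ℝ) ^ 2 < (δ / 2) ^ M' ^ 4 * M) (hW : 8 * (W : ℝ) ≤ δ * M)
    (hload : ∀ i, #{q : J × (Fin 4 × Fin M') | f q.1 q.2.1 = i} ≤ W)
    (hd : ∀ j, δ * (M : ℝ) ^ 4 ≤ ∑ a, ∑ b, ∑ c, ∑ d,
      (if R (β (f j 0) a) (β (f j 1) b) (β (f j 2) c) (β (f j 3) d) then 1 else 0 : ℝ)) :
    ∃ φ : J → Fin 4 × Fin M' → Fin M, (∀ j, BlowupHom R fun p => β (f j p.1) (φ j p)) ∧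
      ∀ j j' p p', f j p.1 = f j' p'.1 → φ j p = φ j' p' → j = j' ∧ p = p' := by
  classical
  suffices H : ∀ S : Finset J, ∃ φ : J → Fin 4 × Fin M' → Fin M,
      (∀ j ∈ S, BlowupHom R fun p => β (f j p.1) (φ j p)) ∧
      ∀ j ∈ S, ∀ j' ∈ S, ∀ p p', f j p.1 = f j' p'.1 → φ j p = φ j' p' → j = j' ∧ p = p' by
    obtain ⟨φ, h1, h2⟩ := H univ
    exact ⟨φ, fun j => h1 j (mem_univ _), fun j j' => h2 j (mem_univ _) j' (mem_univ _)⟩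
  intro S
  induction S using Finset.induction_on with
  | empty =>
    by_cases hM0 : M = 0
    · exfalso
      rw [hM0, Nat.cast_zero, mul_zero] at hM
      exact absurd hM (not_lt.2 (by positivity))
    · exact ⟨fun _ _ => ⟨0, Nat.pos_of_ne_zero hM0⟩, by simp, by simp⟩
  | insert j S hj ih =>
    obtain ⟨φ, h1, h2⟩ := ih
    let U : ι → Finset (Fin M) := fun i =>
      ({q : J × (Fin 4 × Fin M') | f q.1 q.2.1 = i} : Finset _).image fun q => φ q.1 q.2
    have hU : ∀ c, (#(U (f j c)) : ℝ) ≤ W := fun c =>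
      Nat.cast_le.2 (card_image_le.trans (hload _))
    have h3 := sum_ite_and_notMem_ge
      (fun a b c d => R (β (f j 0) a) (β (f j 1) b) (β (f j 2) c) (β (f j 3) d))
      (fun c => U (f j c)) hU
    have hM0 : (0 : ℝ) ≤ (M : ℝ) ^ 3 := by positivity
    obtain ⟨ψ, hψ, hψR⟩ := exists_injective_blowupHom (fun a b c d : Fin M =>
      R (β (f j 0) a) (β (f j 1) b) (β (f j 2) c) (β (f j 3) d) ∧
        a ∉ U (f j 0) ∧ b ∉ U (f j 1) ∧ c ∉ U (f j 2) ∧ d ∉ U (f j 3)) (δ := δ / 2)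
        (by positivity) M' (by simpa using hM) (by
        refine le_trans ?_ h3
        have := hd j
        rw [Fintype.card_fin]
        nlinarith [mul_le_mul_of_nonneg_right hW hM0])
    have hav : ∀ p, ψ p ∉ U (f j p.1) := by
      rintro ⟨c, x⟩
      have := hψR x x x x
      fin_cases c
      · exact this.2.1
      · exact this.2.2.1
      · exact this.2.2.2.1
      · exact this.2.2.2.2
    have hne : ∀ j' ∈ S, j' ≠ j := fun j' hj' h => hj (h ▸ hj')
    refine ⟨Function.update φ j ψ, ?_, ?_⟩
    · intro j' hj'
      rcases mem_insert.1 hj' with rfl | hj'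
      · rw [Function.update_self]
        exact fun i k l o => (hψR i k l o).1
      · rw [Function.update_of_ne (hne j' hj')]
        exact h1 j' hj'
    · intro j₁ hj₁ j₂ hj₂ p p' hf hp
      rcases mem_insert.1 hj₁ with rfl | hS₁ <;> rcases mem_insert.1 hj₂ with rfl | hS₂
      · rw [Function.update_self] at hp
        exact ⟨rfl, hψ hp⟩
      · rw [Function.update_self, Function.update_of_ne (hne _ hS₂)] at hp
        refine absurd ?_ (hav p)
        rw [hp, hf]
        exact mem_image.2 ⟨(j₂, p'), by simp, rfl⟩
      · rw [Function.update_self, Function.update_of_ne (hne _ hS₁)] at hp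
        refine absurd ?_ (hav p')
        rw [← hp, ← hf]
        exact mem_image.2 ⟨(j₁, p), by simp, rfl⟩
      · rw [Function.update_of_ne (hne _ hS₁), Function.update_of_ne (hne _ hS₂)] at hp
        exact h2 _ hS₁ _ hS₂ p p' hf hp

/-- Retiling: the greedy embedding of the previous lemma, together with what remains of an old
tiling. -/
theorem HasTiling.refine {V J : Type*} [Fintype J] {M M' t l q : ℕ}
    {R : V → V → V → V → Prop} [∀ a b c d, Decidable (R a b c d)]
    (β : (Fin t × Fin 4) ⊕ Fin l → Fin M → V)
    (hβ : Function.Injective fun x : ((Fin t × Fin 4) ⊕ Fin l) × Fin M => β x.1 x.2)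
    (hβR : ∀ s, BlowupHom R fun p : Fin 4 × Fin M => β (Sum.inl (s, p.1)) p.2)
    (f : J → Fin 4 → (Fin t × Fin 4) ⊕ Fin l) {δ : ℝ} (hδ : 0 ≤ δ) (W : ℕ)
    (hM : (4 * M' : ℝ) ^ 2 < (δ / 2) ^ M' ^ 4 * M) (hW : 8 * (W : ℝ) ≤ δ * M)
    (hload : ∀ i, #{x : J × (Fin 4 × Fin M') | f x.1 x.2.1 = i} ≤ W)
    (hd : ∀ j, δ * (M : ℝ) ^ 4 ≤ ∑ a, ∑ b, ∑ c, ∑ d,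
      (if R (β (f j 0) a) (β (f j 1) b) (β (f j 2) c) (β (f j 3) d) then 1 else 0 : ℝ))
    (hq : q * M' + W ≤ M) : HasTiling R M' (Fintype.card J + t * q) := by
  obtain ⟨φ, h1, h2⟩ := exists_disjoint_blowupHom R β f hδ W hM hW hload hd
  let U : (Fin t × Fin 4) ⊕ Fin l → Finset (Fin M) := fun i =>
    ({x : J × (Fin 4 × Fin M') | f x.1 x.2.1 = i} : Finset _).image fun x => φ x.1 x.2
  have hU : ∀ i, #(U i) ≤ W := fun i => card_image_le.trans (hload i)
  have hemb : ∀ i, ∃ g : Fin q × Fin M' → Fin M, Function.Injective g ∧ ∀ x, g x ∉ U i := by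
    intro i
    have : Fintype.card (Fin q × Fin M') ≤ Fintype.card {x // x ∈ (U i)ᶜ} := by
      rw [Fintype.card_coe, card_compl, Fintype.card_prod]
      simp only [Fintype.card_fin]
      have := hU i
      omega
    obtain ⟨g⟩ := Function.Embedding.nonempty_of_card_le this
    exact ⟨fun x => g x, fun x y h => g.injective (Subtype.ext h), fun x =>
      mem_compl.1 (g x).2⟩
  choose g hg hgU using hemb
  let Φ : J ⊕ (Fin t × Fin q) → Fin 4 × Fin M' → V := Sum.elim
    (fun j p => β (f j p.1) (φ j p))
    (fun y p => β (Sum.inl (y.1, p.1)) (g (Sum.inl (y.1, p.1)) (y.2, p.2)))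
  have hmem : ∀ j p, φ j p ∈ U (f j p.1) := fun j p => mem_image.2 ⟨(j, p), by simp, rfl⟩
  have key := HasTiling.of_fintype (R := R) Φ ?_ ?_
  · simpa using key
  · rintro ⟨j | y, p⟩ ⟨j' | y', p'⟩ h
    · have := @hβ (f j p.1, φ j p) (f j' p'.1, φ j' p') h
      rw [Prod.mk.injEq] at this
      obtain ⟨rfl, rfl⟩ := h2 j j' p p' this.1 this.2
      rfl
    · have := @hβ (f j p.1, φ j p) (Sum.inl (y'.1, p'.1), g (Sum.inl (y'.1, p'.1)) (y'.2, p'.2)) h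
      rw [Prod.mk.injEq] at this
      refine absurd (hmem j p) ?_
      rw [this.1, this.2]
      exact hgU _ _
    · have := @hβ (Sum.inl (y.1, p.1), g (Sum.inl (y.1, p.1)) (y.2, p.2)) (f j' p'.1, φ j' p') h
      rw [Prod.mk.injEq] at this
      refine absurd (hmem j' p') ?_
      rw [← this.1, ← this.2]
      exact hgU _ _
    · obtain ⟨s, u⟩ := y
      obtain ⟨s', u'⟩ := y'
      obtain ⟨c, x⟩ := p
      obtain ⟨c', x'⟩ := p'
      have := @hβ (Sum.inl (s, c), g (Sum.inl (s, c)) (u, x))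
        (Sum.inl (s', c'), g (Sum.inl (s', c')) (u', x')) h
      simp only [Prod.mk.injEq, Sum.inl.injEq] at this
      obtain ⟨⟨rfl, rfl⟩, h3⟩ := this
      have := hg _ h3
      simp only [Prod.mk.injEq] at this
      obtain ⟨rfl, rfl⟩ := this
      rfl
  · rintro (j | ⟨s, u⟩)
    · exact h1 j
    · exact fun i j k l => hβR s (g _ (u, i)) (g _ (u, j)) (g _ (u, k)) (g _ (u, l))

section Blocks

variable {V ι : Type*} [Fintype V] [Fintype ι] {M : ℕ}

theorem sum_le_sum_blocks {β : ι → Fin M → V}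
    (hβ : Function.Injective fun x : ι × Fin M => β x.1 x.2)
    (hcover : Fintype.card V ≤ Fintype.card ι * M + M) {g : V → ℝ} {B : ℝ} (hB : 0 ≤ B)
    (hg : ∀ v, g v ≤ B) : ∑ v, g v ≤ ∑ i, ∑ a, g (β i a) + M * B := by
  classical
  let S : Finset V := univ.map ⟨fun x : ι × Fin M => β x.1 x.2, hβ⟩
  have hS : ∑ v ∈ S, g v = ∑ i, ∑ a, g (β i a) := by
    rw [sum_map, Fintype.sum_prod_type]
    rfl
  have hc : #Sᶜ ≤ M := by
    rw [card_compl, card_map, card_univ, Fintype.card_prod, Fintype.card_fin]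
    omega
  rw [← sum_add_sum_compl S, hS]
  refine add_le_add_right ?_ _
  calc ∑ v ∈ Sᶜ, g v ≤ #Sᶜ • B := sum_le_card_nsmul _ _ _ fun v _ => hg v
    _ ≤ M * B := by
      rw [nsmul_eq_mul]
      exact mul_le_mul_of_nonneg_right (Nat.cast_le.2 hc) hB

theorem sum_interleave {A : Type*} [Fintype A] (F : ι → A → ι → A → ι → A → ℝ) :
    ∑ j, ∑ y, ∑ k, ∑ z, ∑ l, ∑ w, F j y k z l w =
      ∑ j, ∑ k, ∑ l, ∑ y, ∑ z, ∑ w, F j y k z l w := by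
  refine sum_congr rfl fun j _ => ?_
  rw [sum_comm]
  refine sum_congr rfl fun k _ => ?_
  rw [sum_comm (s := (univ : Finset ι))]
  refine sum_congr rfl fun y _ => ?_
  rw [sum_comm]

/-- Threefold version of `sum_le_sum_blocks`. -/
theorem sum_triple_le_sum_blocks {β : ι → Fin M → V}
    (hβ : Function.Injective fun x : ι × Fin M => β x.1 x.2)
    (hcover : Fintype.card V ≤ Fintype.card ι * M + M) {g : V → V → V → ℝ} {B : ℝ} (hB : 0 ≤ B)
    (hg : ∀ b c d, g b c d ≤ B) :
    ∑ b, ∑ c, ∑ d, g b c d ≤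
      ∑ j, ∑ k, ∑ l, ∑ y, ∑ z, ∑ w, g (β j y) (β k z) (β l w) +
        3 * M * (Fintype.card V : ℝ) ^ 2 * B := by
  set N : ℝ := (Fintype.card V : ℝ) with hN
  have hN0 : 0 ≤ N := Nat.cast_nonneg _
  have hb : (Fintype.card ι * M : ℝ) ≤ N := by
    have := Fintype.card_le_of_injective _ hβ
    rw [Fintype.card_prod, Fintype.card_fin] at this
    rw [hN]
    exact_mod_cast this
  have h1 : ∀ b c, ∑ d, g b c d ≤ N * B := fun b c => by
    have := sum_le_card_nsmul univ (fun d => g b c d) B fun d _ => hg b c d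
    rwa [nsmul_eq_mul, card_univ] at this
  have h2 : ∀ b, ∑ c, ∑ d, g b c d ≤ N * (N * B) := fun b => by
    have := sum_le_card_nsmul univ (fun c => ∑ d, g b c d) (N * B) fun c _ => h1 b c
    rwa [nsmul_eq_mul, card_univ] at this
  have e3 := sum_le_sum_blocks hβ hcover (by positivity) h2
  have e2 : ∀ b, ∑ c, ∑ d, g b c d ≤ ∑ k, ∑ z, ∑ d, g b (β k z) d + M * (N * B) := fun b =>
    sum_le_sum_blocks hβ hcover (by positivity) (h1 b)
  have e1 : ∀ b c, ∑ d, g b c d ≤ ∑ l, ∑ w, g b c (β l w) + M * B := fun b c =>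
    sum_le_sum_blocks hβ hcover hB (hg b c)
  have f2 : ∀ b, ∑ c, ∑ d, g b c d ≤
      ∑ k, ∑ z, ∑ l, ∑ w, g b (β k z) (β l w) + (N * (M * B) + M * (N * B)) := by
    intro b
    have : ∑ k, ∑ z, ∑ d, g b (β k z) d ≤
        ∑ k, ∑ z, (∑ l, ∑ w, g b (β k z) (β l w) + M * B) :=
      sum_le_sum fun k _ => sum_le_sum fun z _ => e1 _ _
    simp only [sum_add_distrib, sum_const, card_univ, nsmul_eq_mul, Fintype.card_fin] at this
    have h3 : (Fintype.card ι : ℝ) * (M * (M * B)) ≤ N * (M * B) := by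
      rw [← mul_assoc]
      exact mul_le_mul_of_nonneg_right hb (by positivity)
    linarith [e2 b]
  have f3 : ∑ j, ∑ y, ∑ c, ∑ d, g (β j y) c d ≤
      ∑ j, ∑ y, (∑ k, ∑ z, ∑ l, ∑ w, g (β j y) (β k z) (β l w) +
        (N * (M * B) + M * (N * B))) :=
    sum_le_sum fun j _ => sum_le_sum fun y _ => f2 _
  simp only [sum_add_distrib, sum_const, card_univ, nsmul_eq_mul, Fintype.card_fin] at f3
  rw [sum_interleave fun j y k z l w => g (β j y) (β k z) (β l w)] at f3
  have h4 : (Fintype.card ι * M : ℝ) * (2 * (N * M * B)) ≤ N * (2 * (N * M * B)) :=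
    mul_le_mul_of_nonneg_right hb (by positivity)
  linarith

open Classical in
/-- If the vertex set is cut into blocks, then the dense quadruples of blocks have a perfect
fractional matching. -/
theorem exists_fractional_of_blocks [Nonempty ι] (hM : 0 < M) {R : V → V → V → V → Prop} {γ : ℝ}
    (hγ : 0 < γ) (hR : MinDegreeGE R (37 / 64 + γ)) {β : ι → Fin M → V}
    (hβ : Function.Injective fun x : ι × Fin M => β x.1 x.2)
    (hcover : Fintype.card V ≤ Fintype.card ι * M + M) (hb : 4 / γ < Fintype.card ι) :
    ∃ (r : ℕ) (e : Fin r → Fin 4 → ι) (x : Fin r → ℝ), r ≤ Fintype.card ι + 1 ∧ (∀ a, 0 ≤ x a) ∧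
      (∀ s, γ / 4 * (M : ℝ) ^ 4 ≤ ∑ a, ∑ b, ∑ c, ∑ d,
        (if R (β (e s 0) a) (β (e s 1) b) (β (e s 2) c) (β (e s 3) d) then 1 else 0 : ℝ)) ∧
      ∀ i, ∑ a, x a * (#{j | e a j = i} : ℝ) = 1 := by
  refine exists_fractional_perfect_matching (fun i j k l => γ / 4 * (M : ℝ) ^ 4 ≤
    ∑ a, ∑ b, ∑ c, ∑ d,
      (if R (β i a) (β j b) (β k c) (β l d) then 1 else 0 : ℝ)) fun i => ?_
  set N : ℝ := (Fintype.card V : ℝ) with hN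
  have hM' : (0 : ℝ) < M := Nat.cast_pos.2 hM
  have hbN : (Fintype.card ι * M : ℝ) ≤ N := by
    have := Fintype.card_le_of_injective _ hβ
    rw [Fintype.card_prod, Fintype.card_fin] at this
    rw [hN]
    exact_mod_cast this
  set b : ℝ := (Fintype.card ι : ℝ) with hbdef
  have hb0 : 0 < b := lt_trans (by positivity) hb
  have h1 : M * ((37 / 64 + γ) * N ^ 3) ≤
      ∑ b, ∑ c, ∑ d, ∑ a, (if R (β i a) b c d then 1 else 0 : ℝ) := by
    have : ∑ a : Fin M, (37 / 64 + γ) * N ^ 3 ≤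
        ∑ a, ∑ b, ∑ c, ∑ d, (if R (β i a) b c d then 1 else 0 : ℝ) :=
      sum_le_sum fun a _ => hR (β i a)
    rw [sum_const, card_univ, nsmul_eq_mul, Fintype.card_fin] at this
    refine this.trans (le_of_eq ?_)
    rw [sum_comm]
    refine sum_congr rfl fun b _ => ?_
    rw [sum_comm]
    refine sum_congr rfl fun c _ => ?_
    rw [sum_comm]
  have h2 := sum_triple_le_sum_blocks hβ hcover
    (g := fun b c d => ∑ a, (if R (β i a) b c d then 1 else 0 : ℝ)) (B := M) hM'.le
    (fun b c d => by
      have := sum_le_card_nsmul univ (fun a : Fin M => (if R (β i a) b c d then 1 else 0 : ℝ)) 1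
        fun a _ => by split_ifs <;> norm_num
      simpa using this)
  have h3 : ∀ j k l, ∑ y, ∑ z, ∑ w, ∑ a,
      (if R (β i a) (β j y) (β k z) (β l w) then 1 else 0 : ℝ) ≤
      (if γ / 4 * (M : ℝ) ^ 4 ≤ ∑ a, ∑ b, ∑ c, ∑ d,
        (if R (β i a) (β j b) (β k c) (β l d) then 1 else 0 : ℝ) then 1 else 0 : ℝ) *
        (M : ℝ) ^ 4 + γ / 4 * (M : ℝ) ^ 4 := by
    intro j k l
    have e : ∑ y, ∑ z, ∑ w, ∑ a,
        (if R (β i a) (β j y) (β k z) (β l w) then 1 else 0 : ℝ) = ∑ a, ∑ b, ∑ c, ∑ d,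
        (if R (β i a) (β j b) (β k c) (β l d) then 1 else 0 : ℝ) := by
      symm
      rw [sum_comm]
      refine sum_congr rfl fun b _ => ?_
      rw [sum_comm]
      refine sum_congr rfl fun c _ => ?_
      rw [sum_comm]
    rw [e]
    split_ifs with h
    · have : ∑ a, ∑ b, ∑ c, ∑ d,
          (if R (β i a) (β j b) (β k c) (β l d) then 1 else 0 : ℝ) ≤
          ∑ a : Fin M, ∑ b : Fin M, ∑ c : Fin M, ∑ d : Fin M, (1 : ℝ) :=
        sum_le_sum fun a _ => sum_le_sum fun b _ => sum_le_sum fun c _ => sum_le_sum fun d _ => by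
          split_ifs <;> norm_num
      simp only [sum_const, card_univ, Fintype.card_fin, nsmul_eq_mul, mul_one] at this
      have h5 : 0 ≤ γ / 4 * (M : ℝ) ^ 4 := by positivity
      nlinarith
    · linarith [not_le.1 h]
  have h4 := (h1.trans h2).trans (add_le_add_left
    (sum_le_sum fun j _ => sum_le_sum fun k _ => sum_le_sum fun l _ => h3 j k l) _)
  simp only [sum_add_distrib, sum_const, card_univ, nsmul_eq_mul, ← sum_mul] at h4
  rw [← hbdef, ← hN] at h4
  set Z : ℝ := ∑ j, ∑ k, ∑ l, (if γ / 4 * (M : ℝ) ^ 4 ≤ ∑ a, ∑ b, ∑ c, ∑ d,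
        (if R (β i a) (β j b) (β k c) (β l d) then 1 else 0 : ℝ) then 1 else 0 : ℝ)
  obtain ⟨y, hyN⟩ : ∃ y : ℝ, N = y * M := ⟨N / M, by field_simp⟩
  rw [hyN] at h4 hbN
  have hy : b ≤ y := le_of_mul_le_mul_right hbN hM'
  have h5 : (37 / 64 + γ) * y ^ 3 ≤ Z + γ / 4 * b ^ 3 + 3 * y ^ 2 := by
    refine le_of_mul_le_mul_right ?_ (pow_pos hM' 4)
    linarith
  have h6 : 4 < γ * b := by rwa [div_lt_iff₀' hγ] at hb
  have h7 : b ^ 2 * ((37 / 64 + γ) * b - 3) ≤ y ^ 2 * ((37 / 64 + γ) * y - 3) := by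
    refine mul_le_mul (pow_le_pow_left₀ hb0.le hy 2) ?_ ?_ (by positivity)
    · have := mul_le_mul_of_nonneg_left hy (show 0 ≤ 37 / 64 + γ by positivity)
      linarith
    · linarith
  nlinarith [mul_lt_mul_of_pos_right h6 (pow_pos hb0 2)]

end Blocks

/-- Cut the vertex set into blocks of size `M`, four of them for each member of a tiling. -/
theorem HasTiling.exists_blocks {V : Type*} [Fintype V] {R : V → V → V → V → Prop} {M t : ℕ}
    (hM : 0 < M) (h : HasTiling R M t) : ∃ (l : ℕ) (β : (Fin t × Fin 4) ⊕ Fin l → Fin M → V),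
      (Function.Injective fun x : ((Fin t × Fin 4) ⊕ Fin l) × Fin M => β x.1 x.2) ∧
      (∀ s, BlowupHom R fun p : Fin 4 × Fin M => β (Sum.inl (s, p.1)) p.2) ∧
      Fintype.card V < (t * 4 + l) * M + M := by
  classical
  obtain ⟨φ, hφ, hφR⟩ := h
  let C : Finset V := (univ.map ⟨_, hφ⟩)ᶜ
  have hC : #C = Fintype.card V - t * (4 * M) := by
    rw [card_compl, card_map, card_univ]
    simp
  have hle : t * (4 * M) ≤ Fintype.card V := by
    have := Fintype.card_le_of_injective _ hφ
    simpa using this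
  have hCc : Fintype.card (Fin (#C / M) × Fin M) ≤ Fintype.card {x // x ∈ C} := by
    rw [Fintype.card_coe, Fintype.card_prod]
    simp only [Fintype.card_fin]
    exact Nat.div_mul_le_self _ _
  obtain ⟨g⟩ := Function.Embedding.nonempty_of_card_le hCc
  have hg : ∀ x (q : Fin t × (Fin 4 × Fin M)), (g x : V) ≠ φ q.1 q.2 := fun x q h =>
    mem_compl.1 (g x).2 (mem_map.2 ⟨q, mem_univ _, h.symm⟩)
  refine ⟨#C / M, Sum.elim (fun y a => φ y.1 (y.2, a)) fun i a => g (i, a), ?_, ?_, ?_⟩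
  · rintro ⟨⟨s, c⟩ | i, a⟩ ⟨⟨s', c'⟩ | i', a'⟩ h
    · have := @hφ (s, (c, a)) (s', (c', a')) h
      simp only [Prod.mk.injEq] at this
      obtain ⟨rfl, rfl, rfl⟩ := this
      rfl
    · exact absurd h.symm (hg _ (s, (c, a)))
    · exact absurd h (hg _ (s', (c', a')))
    · have := g.injective (Subtype.ext h)
      simp only [Prod.mk.injEq] at this
      obtain ⟨rfl, rfl⟩ := this
      rfl
  · exact fun s => hφR s
  · have := Nat.lt_div_mul_add (a := #C) hM
    rw [hC] at this ⊢
    have e : (t * 4 + (Fintype.card V - t * (4 * M)) / M) * M + M =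
      t * (4 * M) + ((Fintype.card V - t * (4 * M)) / M * M + M) := by ring
    omega

/-- A tiling which does not cover almost everything can be replaced by one which covers more, at
the price of using smaller parts. -/
theorem HasTiling.improve {V : Type*} [Fintype V] {R : V → V → V → V → Prop} {γ ε c : ℝ}
    (hγ : 0 < γ) (hε : 0 < ε) (hR : MinDegreeGE R (37 / 64 + γ)) {D s M' M t : ℕ} (hM' : 0 < M')
    (hMdef : M = D * s * M')
    (hD : 32 / γ ≤ D) (hs : 32 / ε ≤ s)
    (hbig : (4 * M' : ℝ) ^ 2 < (γ / 4 / 2) ^ M' ^ 4 * M)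
    (hN : 4 * M / ε ≤ Fintype.card V)
    (hN' : M * (4 / γ + 2) ≤ Fintype.card V) (hc : c ≤ 1 - ε)
    (ht : HasTiling R M t) (hct : c * Fintype.card V ≤ 4 * M * t) :
    ∃ t', HasTiling R M' t' ∧ (c + ε / (2 * D)) * Fintype.card V ≤ 4 * M' * t' := by
  classical
  have hD0 : (0 : ℝ) < D := lt_of_lt_of_le (by positivity) hD
  have hs0 : (0 : ℝ) < s := lt_of_lt_of_le (by positivity) hs
  have hM'0 : (0 : ℝ) < M' := Nat.cast_pos.2 hM'
  have hMpos : 0 < M := by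
    rw [hMdef]
    have h1 : 0 < D := Nat.cast_pos.1 hD0
    have h2 : 0 < s := Nat.cast_pos.1 hs0
    positivity
  have hM0 : (0 : ℝ) < M := Nat.cast_pos.2 hMpos
  have hMe : (M : ℝ) = D * s * M' := by rw [hMdef]; push_cast; ring
  obtain ⟨l, β, hβ, hβR, hl⟩ := ht.exists_blocks hMpos
  set N : ℝ := (Fintype.card V : ℝ) with hNdef
  have hcard : Fintype.card ((Fin t × Fin 4) ⊕ Fin l) = t * 4 + l := by simp
  set b : ℝ := ((t * 4 + l : ℕ) : ℝ) with hb
  have hl' : N < b * M + M := by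
    rw [hNdef, hb]
    exact_mod_cast hl
  have hbN : b * M ≤ N := by
    have := Fintype.card_le_of_injective _ hβ
    rw [Fintype.card_prod, Fintype.card_fin, hcard] at this
    rw [hNdef, hb]
    exact_mod_cast this
  have hbγ : 4 / γ < b := by
    have : M * (4 / γ + 1) < M * b := by linarith
    have := lt_of_mul_lt_mul_left this hM0.le
    linarith
  have hb0 : 0 < b := lt_trans (by positivity) hbγ
  have : Nonempty ((Fin t × Fin 4) ⊕ Fin l) := by
    rw [← Fintype.card_pos_iff, hcard]
    exact Nat.cast_pos.1 hb0
  obtain ⟨r, e, x, hr, hx, hd, hsum⟩ := exists_fractional_of_blocks hMpos hγ hR hβ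
    (by rw [hcard]; exact hl.le) (by rw [hcard]; exact hbγ)
  replace hsum : ∀ i, ∑ a, x a * (#{j | e a j = i} : ℝ) = 1 := fun i => by convert hsum i
  have hload : ∀ i, #{q : (Σ a : Fin r, Fin ⌊x a * s⌋₊) × (Fin 4 × Fin M') |
      (fun j : (Σ a : Fin r, Fin ⌊x a * s⌋₊) => e j.1) q.1 q.2.1 = i} ≤ s * M' := by
    intro i
    rw [← Nat.cast_le (α := ℝ), card_filter]
    push_cast
    simp only [Fintype.sum_prod_type, Fintype.sum_sigma]
    calc ∑ a, ∑ _y : Fin ⌊x a * s⌋₊, ∑ c, ∑ _z : Fin M', (if e a c = i then 1 else 0 : ℝ)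
        = ∑ a, (⌊x a * s⌋₊ : ℝ) * ∑ c, M' * (if e a c = i then 1 else 0 : ℝ) := by
          simp only [sum_const, card_univ, Fintype.card_fin, nsmul_eq_mul]
      _ ≤ ∑ a, (x a * s) * ∑ c, M' * (if e a c = i then 1 else 0 : ℝ) := by
          refine sum_le_sum fun a _ => mul_le_mul_of_nonneg_right
            (Nat.floor_le (mul_nonneg (hx a) hs0.le)) (sum_nonneg fun c _ => ?_)
          split_ifs <;> simp
      _ = s * M' * ∑ a, x a * (#{j | e a j = i} : ℝ) := by
          rw [mul_sum]
          refine sum_congr rfl fun a _ => ?_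
          rw [← mul_sum, card_filter]
          push_cast
          ring
      _ = s * M' := by rw [hsum, mul_one]
  have hD1 : 1 ≤ D := Nat.cast_pos.1 hD0
  have hγD : 32 ≤ γ * D := by rwa [div_le_iff₀' hγ] at hD
  have hεs : 32 ≤ ε * s := by rwa [div_le_iff₀' hε] at hs
  have hnew := HasTiling.refine (q := (D - 1) * s) β hβ hβR
    (fun j : (Σ a : Fin r, Fin ⌊x a * s⌋₊) => e j.1) (δ := γ / 4) (by positivity) (s * M') hbig
    (by
      rw [hMe]
      push_cast
      have : 0 < (s : ℝ) * M' := by positivity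
      nlinarith) hload (fun j => by convert hd j.1) (by
      rw [hMdef]
      obtain ⟨D', rfl⟩ : ∃ D', D = D' + 1 := ⟨D - 1, by omega⟩
      rw [Nat.add_sub_cancel]
      exact le_of_eq (by ring))
  refine ⟨_, hnew, ?_⟩
  have hJ : s * (b / 4) - (b + 1) ≤ (Fintype.card (Σ a : Fin r, Fin ⌊x a * s⌋₊) : ℝ) := by
    rw [Fintype.card_sigma]
    push_cast
    simp only [Fintype.card_fin]
    have h1 : ∑ a, (x a * s - 1) ≤ ∑ a, (⌊x a * s⌋₊ : ℝ) :=
      sum_le_sum fun a _ => (Nat.sub_one_lt_floor _).le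
    rw [sum_sub_distrib, ← sum_mul, sum_const, card_univ, Fintype.card_fin, nsmul_eq_mul,
      mul_one] at h1
    have h2 : ∑ i, ∑ a, x a * (#{j | e a j = i} : ℝ) = b := by
      simp only [hsum, sum_const, card_univ, hcard, nsmul_eq_mul, mul_one, hb]
    have h3 : (∑ a, x a) * 4 = b := by
      rw [← h2, sum_comm, sum_mul]
      refine sum_congr rfl fun a _ => ?_
      rw [← mul_sum]
      congr 1
      have := card_eq_sum_card_fiberwise (f := e a) (s := univ) (t := univ) (by simp)
      rw [card_univ, Fintype.card_fin] at this
      exact_mod_cast this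
    have h4 : (r : ℝ) ≤ b + 1 := by
      rw [hcard] at hr
      rw [hb]
      exact_mod_cast hr
    nlinarith
  set K : ℝ := (Fintype.card (Σ a : Fin r, Fin ⌊x a * s⌋₊) : ℝ) with hK
  have hcast : ((Fintype.card (Σ a : Fin r, Fin ⌊x a * s⌋₊) + t * ((D - 1) * s) : ℕ) : ℝ) =
      K + t * ((D - 1) * s) := by
    rw [hK]
    push_cast [Nat.cast_sub hD1]
    ring
  rw [hcast]
  rw [div_le_iff₀ hε] at hN
  have hT : c * N * (1 - 1 / D) ≤ 4 * M * t * (1 - 1 / D) := by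
    refine mul_le_mul_of_nonneg_right hct ?_
    have : 1 / (D : ℝ) ≤ 1 := by
      rw [div_le_one hD0]
      exact_mod_cast hD1
    linarith
  have hMb : (M : ℝ) ≤ N := by
    have : (M : ℝ) * 1 ≤ M * (4 / γ + 2) := mul_le_mul_of_nonneg_left (by
      have : 0 < 4 / γ := by positivity
      linarith) hM0.le
    linarith
  have e1 : 4 * (M : ℝ) * t * (1 - 1 / D) = 4 * M' * (t * ((D - 1) * s)) := by
    rw [hMe]
    field_simp
  have e2 : 4 * (M' : ℝ) * (s * (b / 4) - (b + 1)) =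
      (b * M) / D - 4 * ((b * M + M) / (D * s)) := by
    rw [hMe]
    field_simp
  have e3 : (b * M + M) / (D * s) ≤ 2 * N / (D * s) := by
    refine div_le_div_of_nonneg_right ?_ (by positivity)
    linarith
  have e4 : 2 * N / (D * s) ≤ ε * N / 16 / D := by
    rw [div_le_div_iff₀ (by positivity) hD0]
    have : 0 ≤ N * D := by positivity
    nlinarith
  have e5 : (N - M) / D ≤ b * M / D := div_le_div_of_nonneg_right (by linarith) hD0.le
  have e6 : (N - ε * N / 4) / D ≤ (N - M) / D := div_le_div_of_nonneg_right (by linarith) hD0.le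
  have e7 : (c * N) / D ≤ ((1 - ε) * N) / D :=
    div_le_div_of_nonneg_right (mul_le_mul_of_nonneg_right hc (Nat.cast_nonneg _)) hD0.le
  have e8 : 4 * (M' : ℝ) * (s * (b / 4) - (b + 1)) ≤ 4 * M' * K :=
    mul_le_mul_of_nonneg_left hJ (by positivity)
  have e9 : 0 ≤ ε * N / D := by positivity
  have f1 : (c + ε / (2 * D)) * N = c * N + (ε * N / D) / 2 := by
    field_simp
  have f2 : c * N * (1 - 1 / D) = c * N - c * N / D := by ring
  have f3 : (N - ε * N / 4) / D = N / D - (ε * N / D) / 4 := by ring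
  have f4 : ε * N / 16 / D = (ε * N / D) / 16 := by ring
  have f5 : (1 - ε) * N / D = N / D - ε * N / D := by ring
  rw [f1]
  rw [mul_add]
  linarith

/-- Almost perfect tilings. -/
theorem exists_almost_tiling {γ ε : ℝ} (hγ : 0 < γ) (hε : 0 < ε) {m : ℕ} (hm : 0 < m) :
    ∃ N₀ : ℕ, ∀ (V : Type) [Fintype V] (R : V → V → V → V → Prop), MinDegreeGE R (37 / 64 + γ) →
      N₀ ≤ Fintype.card V → ∃ t, HasTiling R m t ∧ (1 - ε) * Fintype.card V ≤ 4 * m * t := by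
  obtain ⟨D, hD⟩ := exists_nat_ge (32 / γ)
  have hD0 : (0 : ℝ) < D := lt_of_lt_of_le (by positivity) hD
  set η := ε / (2 * D) with hη
  have hη0 : 0 < η := by positivity
  obtain ⟨k, hk⟩ := exists_nat_ge ((1 - ε) / η)
  rw [div_le_iff₀ hη0] at hk
  have H : ∀ (k m : ℕ), 0 < m → ∃ N₀ : ℕ, ∀ (V : Type) [Fintype V] (R : V → V → V → V → Prop),
      MinDegreeGE R (37 / 64 + γ) → N₀ ≤ Fintype.card V →
      ∃ t, HasTiling R m t ∧ min (k * η) (1 - ε) * Fintype.card V ≤ 4 * m * t := by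
    intro k
    induction k with
    | zero =>
      intro m _
      refine ⟨0, fun V _ R _ _ => ⟨0, ⟨fun s => s.elim0, fun q => q.1.elim0, fun s => s.elim0⟩, ?_⟩⟩
      have h1 : min (((0 : ℕ) : ℝ) * η) (1 - ε) ≤ 0 := by simp
      have h2 : (0 : ℝ) ≤ Fintype.card V := Nat.cast_nonneg _
      simpa using mul_nonpos_of_nonpos_of_nonneg h1 h2
    | succ k ih =>
      intro m hm
      have hm0 : (0 : ℝ) < m := Nat.cast_pos.2 hm
      set κ := (γ / 4 / 2) ^ m ^ 4 with hκ
      have hκ0 : 0 < κ := by positivity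
      obtain ⟨s, hs⟩ := exists_nat_gt (max (32 / ε) ((4 * m : ℝ) ^ 2 / (κ * (D * m))))
      have hs1 := (le_max_left _ _).trans_lt hs
      have hs2 := (le_max_right _ _).trans_lt hs
      have hs0 : (0 : ℝ) < s := lt_trans (by positivity) hs1
      rw [div_lt_iff₀ (by positivity)] at hs2
      have hM : 0 < D * s * m := by
        have h1 : 0 < D := Nat.cast_pos.1 hD0
        have h2 : 0 < s := Nat.cast_pos.1 hs0
        positivity
      obtain ⟨N₁, hN₁⟩ := ih (D * s * m) hM
      obtain ⟨N₂, hN₂⟩ := exists_nat_ge (max (4 * (D * s * m : ℕ) / ε)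
        ((D * s * m : ℕ) * (4 / γ + 2)))
      refine ⟨max N₁ N₂, fun V _ R hR hV => ?_⟩
      obtain ⟨t, ht, hct⟩ := hN₁ V R hR ((le_max_left _ _).trans hV)
      have hV2 : (N₂ : ℝ) ≤ Fintype.card V := Nat.cast_le.2 ((le_max_right _ _).trans hV)
      obtain ⟨t', ht', hct'⟩ := HasTiling.improve hγ hε hR hm rfl hD hs1.le
        (by
          push_cast
          linarith)
        ((le_max_left _ _).trans (hN₂.trans hV2)) ((le_max_right _ _).trans (hN₂.trans hV2))
        (min_le_right _ _) ht hct
      refine ⟨t', ht', le_trans (mul_le_mul_of_nonneg_right ?_ (Nat.cast_nonneg _)) hct'⟩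
      rw [← hη, ← min_add_add_right]
      refine min_le_min (le_of_eq ?_) (by linarith)
      push_cast
      ring
  obtain ⟨N₀, hN₀⟩ := H k m hm
  rw [min_eq_right hk] at hN₀
  exact ⟨N₀, hN₀⟩

theorem card_inter_ge {V T : Type*} [Fintype T] [DecidableEq T] {A : V → Finset T}
    (hA : ∀ u, 9 / 16 * (Fintype.card T : ℝ) ≤ #(A u))
    (x y : V) :
    (Fintype.card T : ℝ) / 8 ≤ #(A x ∩ A y) := by
  have h1 := card_union_add_card_inter (A x) (A y)
  have h2 := card_le_univ (A x ∪ A y)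
  have h3 : (#(A x) : ℝ) + #(A y) ≤ Fintype.card T + #(A x ∩ A y) := by
    exact_mod_cast (by omega : #(A x) + #(A y) ≤ Fintype.card T + #(A x ∩ A y))
  linarith [hA x, hA y]

section Close

variable {V T : Type*} [Fintype V] [DecidableEq T] (A : V → Finset T)

/-- The number of sets of the family `A` containing `τ`. -/
def cover (τ : T) : ℝ := (#{u | τ ∈ A u} : ℝ)

/-- Two members of a family of sets are close if their intersection has large total covering
number. -/
def FamilyClose [Fintype T] (δ : ℝ) (x y : V) : Prop :=
  δ * (Fintype.card V * Fintype.card T) ≤ ∑ τ ∈ A x ∩ A y, cover A τ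

variable {A}

theorem FamilyClose.symm [Fintype T] {δ : ℝ} {x y : V} (h : FamilyClose A δ x y) :
    FamilyClose A δ y x := by
  rwa [FamilyClose, inter_comm]

theorem cover_nonneg (τ : T) : 0 ≤ cover A τ := Nat.cast_nonneg _

theorem cover_le (τ : T) : cover A τ ≤ Fintype.card V := Nat.cast_le.2 (card_le_univ _)

theorem sum_cover (L : Finset T) : ∑ τ ∈ L, cover A τ = ∑ u, (#(A u ∩ L) : ℝ) := by
  have h1 : ∀ τ, cover A τ = ∑ u, (if τ ∈ A u then 1 else 0 : ℝ) := fun τ => by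
    rw [cover, card_filter]
    push_cast
    rfl
  have h2 : ∀ u, (#(A u ∩ L) : ℝ) = ∑ τ ∈ L, (if τ ∈ A u then 1 else 0 : ℝ) := fun u => by
    rw [inter_comm, ← filter_mem_eq_inter, card_filter]
    push_cast
    rfl
  simp only [h1, h2]
  exact sum_comm

variable [Fintype T]

open Classical in
/-- The points whose sets contain many rarely covered elements. -/
noncomputable def exceptional (A : V → Finset T) : Finset V :=
  {u | (Fintype.card T : ℝ) / 16 ≤
    #(A u ∩ ({τ | cover A τ < (Fintype.card V : ℝ) / 4096} : Finset T))}

theorem card_exceptional_le [Nonempty T] : (#(exceptional A) : ℝ) ≤ Fintype.card V / 256 := by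
  classical
  set L : Finset T := {τ | cover A τ < (Fintype.card V : ℝ) / 4096} with hL
  have ht : (0 : ℝ) < Fintype.card T := Nat.cast_pos.2 Fintype.card_pos
  have h1 : ∑ τ ∈ L, cover A τ ≤ Fintype.card T * ((Fintype.card V : ℝ) / 4096) := by
    refine (sum_le_card_nsmul L _ ((Fintype.card V : ℝ) / 4096) fun τ hτ => ?_).trans ?_
    · exact (mem_filter.1 hτ).2.le
    · rw [nsmul_eq_mul]
      exact mul_le_mul_of_nonneg_right (Nat.cast_le.2 (card_le_univ _)) (by positivity)
  have h2 : #(exceptional A) • ((Fintype.card T : ℝ) / 16) ≤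
      ∑ u ∈ exceptional A, (#(A u ∩ L) : ℝ) :=
    card_nsmul_le_sum _ _ _ fun u hu => by
      have := (mem_filter.1 hu).2
      convert this
  have h3 : ∑ u ∈ exceptional A, (#(A u ∩ L) : ℝ) ≤ ∑ u, (#(A u ∩ L) : ℝ) :=
    sum_le_univ_sum_of_nonneg fun u => Nat.cast_nonneg _
  rw [nsmul_eq_mul] at h2
  rw [sum_cover] at h1
  refine le_of_mul_le_mul_right ?_ ht
  linarith

theorem familyClose_of_notMem_exceptional (hA : ∀ u, 9 / 16 * (Fintype.card T : ℝ) ≤ #(A u))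
    {y z : V} (hy : y ∉ exceptional A) : FamilyClose A (1 / 65536) y z := by
  classical
  set L : Finset T := {τ | cover A τ < (Fintype.card V : ℝ) / 4096} with hL
  have h1 : (#(A y ∩ L) : ℝ) ≤ Fintype.card T / 16 := by
    simp only [exceptional, mem_filter, mem_univ, true_and, not_le] at hy
    refine le_of_eq_of_le ?_ hy.le
    congr
  have h2 := card_inter_ge hA y z
  have h3 : #(A y ∩ A z) ≤ #((A y ∩ A z) \ L) + #(A y ∩ L) := by
    rw [← card_sdiff_add_card_inter (A y ∩ A z) L]
    refine Nat.add_le_add_left (card_le_card ?_) _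
    intro τ hτ
    simp only [mem_inter] at hτ ⊢
    exact ⟨hτ.1.1, hτ.2⟩
  have h3' : (#(A y ∩ A z) : ℝ) ≤ #((A y ∩ A z) \ L) + #(A y ∩ L) := by exact_mod_cast h3
  have h4 : #((A y ∩ A z) \ L) • ((Fintype.card V : ℝ) / 4096) ≤
      ∑ τ ∈ (A y ∩ A z) \ L, cover A τ := card_nsmul_le_sum _ _ _ fun τ hτ => by
    have := (mem_sdiff.1 hτ).2
    simpa [hL] using this
  have h5 : ∑ τ ∈ (A y ∩ A z) \ L, cover A τ ≤ ∑ τ ∈ A y ∩ A z, cover A τ :=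
    sum_le_sum_of_subset_of_nonneg sdiff_subset fun τ _ _ => cover_nonneg τ
  refine le_trans ?_ (h4.trans h5)
  rw [nsmul_eq_mul]
  have hn : (0 : ℝ) ≤ Fintype.card V / 4096 := by positivity
  have h6 : (Fintype.card T : ℝ) / 16 ≤ #((A y ∩ A z) \ L) := by linarith
  have := mul_le_mul_of_nonneg_right h6 hn
  linarith

open Classical in
theorem card_familyClose_ge [Nonempty T] (hA : ∀ u, 9 / 16 * (Fintype.card T : ℝ) ≤ #(A u))
    (x : V) : (Fintype.card V : ℝ) / 128 ≤
      #{u | FamilyClose A (1 / 65536) x u ∧ u ∉ exceptional A} := by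
  set n : ℝ := (Fintype.card V : ℝ) with hn
  set t : ℝ := (Fintype.card T : ℝ) with ht
  have ht0 : 0 < t := Nat.cast_pos.2 Fintype.card_pos
  have hn0 : 0 < n := Nat.cast_pos.2 (Fintype.card_pos_iff.2 ⟨x⟩)
  have h1 : n * (t / 8) ≤ ∑ τ ∈ A x, cover A τ := by
    rw [sum_cover]
    have := card_nsmul_le_sum univ (fun u => (#(A u ∩ A x) : ℝ)) (t / 8)
      fun u _ => card_inter_ge hA u x
    rwa [card_univ, nsmul_eq_mul] at this
  have h2 : ∑ u, ∑ τ ∈ A x ∩ A u, cover A τ = ∑ τ ∈ A x, cover A τ ^ 2 := by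
    simp only [← filter_mem_eq_inter, sum_filter]
    rw [sum_comm]
    refine sum_congr rfl fun τ _ => ?_
    rw [← sum_filter, sum_const, nsmul_eq_mul, sq]
    rfl
  have h3 : (n * (t / 8)) ^ 2 ≤ t * ∑ τ ∈ A x, cover A τ ^ 2 := by
    refine (pow_le_pow_left₀ (by positivity) h1 2).trans (sq_sum_le_card_mul_sum_sq.trans ?_)
    exact mul_le_mul_of_nonneg_right (Nat.cast_le.2 (card_le_univ _))
      (sum_nonneg fun τ _ => sq_nonneg _)
  set S : Finset V := {u | FamilyClose A (1 / 65536) x u} with hS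
  have h4 : ∀ u, ∑ τ ∈ A x ∩ A u, cover A τ ≤ (if u ∈ S then n * t else 0) +
      1 / 65536 * (n * t) := by
    intro u
    by_cases hu : u ∈ S
    · rw [if_pos hu]
      have := sum_le_card_nsmul (A x ∩ A u) (cover A) n fun τ _ => cover_le τ
      rw [nsmul_eq_mul] at this
      have h' : (#(A x ∩ A u) : ℝ) * n ≤ t * n :=
        mul_le_mul_of_nonneg_right (Nat.cast_le.2 (card_le_univ _)) hn0.le
      have : 0 < n * t := by positivity
      linarith
    · rw [if_neg hu, zero_add]
      exact (not_le.1 fun h => hu (mem_filter.2 ⟨mem_univ _, h⟩)).le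
  have h5 := sum_le_sum fun u (_ : u ∈ (univ : Finset V)) => h4 u
  rw [h2, sum_add_distrib, sum_ite_mem, univ_inter, sum_const, sum_const, card_univ, nsmul_eq_mul,
    nsmul_eq_mul, ← hn] at h5
  have h6 : n * (n * t ^ 2 / 64) ≤ (#S + n * (1 / 65536)) * (n * t ^ 2) := by
    have := mul_le_mul_of_nonneg_left h5 ht0.le
    linarith
  have h7 : n / 64 ≤ #S + n * (1 / 65536) := by
    have : 0 < n * t ^ 2 := by positivity
    refine le_of_mul_le_mul_right ?_ this
    linarith
  have h8 : #S ≤ #{u | FamilyClose A (1 / 65536) x u ∧ u ∉ exceptional A} +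
      #(exceptional A) := by
    refine (card_le_card ?_).trans (card_union_le _ _)
    intro u hu
    simp only [hS, mem_union, mem_filter, mem_univ, true_and] at hu ⊢
    tauto
  have h8' : (#S : ℝ) ≤ #{u | FamilyClose A (1 / 65536) x u ∧ u ∉ exceptional A} +
      #(exceptional A) := by exact_mod_cast h8
  linarith [card_exceptional_le (A := A)]

open Classical in
/-- Any two points are joined by many paths of length three of the closeness relation. -/
theorem card_close_paths_ge [Nonempty T] (hA : ∀ u, 9 / 16 * (Fintype.card T : ℝ) ≤ #(A u))
    (x y : V) : ((Fintype.card V : ℝ) / 128) ^ 2 ≤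
      #{p : Fin 2 → V | FamilyClose A (1 / 65536) x (p 0) ∧
        FamilyClose A (1 / 65536) (p 0) (p 1) ∧ FamilyClose A (1 / 65536) (p 1) y} := by
  set S : V → Finset V := fun x => {u | FamilyClose A (1 / 65536) x u ∧ u ∉ exceptional A}
  have h1 : #(S x ×ˢ S y) ≤ #{p : Fin 2 → V | FamilyClose A (1 / 65536) x (p 0) ∧
        FamilyClose A (1 / 65536) (p 0) (p 1) ∧ FamilyClose A (1 / 65536) (p 1) y} := by
    refine card_le_card_of_injOn (fun q => ![q.1, q.2]) ?_ ?_
    · rintro ⟨u, v⟩ h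
      simp only [S, coe_product, Set.mem_prod, mem_coe, mem_filter, mem_univ, true_and] at h
      simp only [mem_coe, mem_filter, mem_univ, true_and]
      exact ⟨h.1.1, familyClose_of_notMem_exceptional hA h.1.2, h.2.1.symm⟩
    · rintro ⟨u, v⟩ _ ⟨u', v'⟩ _ h
      exact Prod.ext (congrFun h 0) (congrFun h 1)
  refine le_trans ?_ (Nat.cast_le.2 h1)
  rw [card_product, Nat.cast_mul, sq]
  exact mul_le_mul (card_familyClose_ge hA x) (card_familyClose_ge hA y) (by positivity)
    (Nat.cast_nonneg _)

end Close

/-- A set spanned by a copy of the complete `4`-partite `4`-graph with parts of size `m`. -/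
def IsTile {V : Type*} [DecidableEq V] (R : V → V → V → V → Prop) (m : ℕ) (S : Finset V) : Prop :=
  ∃ φ : Fin 4 × Fin m → V, Function.Injective φ ∧ BlowupHom R φ ∧ univ.image φ = S

/-- A set which is a disjoint union of tiles. -/
inductive Tiled {V : Type*} [DecidableEq V] (R : V → V → V → V → Prop) (m : ℕ) : Finset V → Prop
  | empty : Tiled R m ∅
  | union {S T : Finset V} : IsTile R m S → Tiled R m T → Disjoint S T → Tiled R m (S ∪ T)

section Tiled

variable {V : Type*} [DecidableEq V] {R : V → V → V → V → Prop} {m : ℕ}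

theorem IsTile.tiled {S : Finset V} (h : IsTile R m S) : Tiled R m S := by
  simpa using Tiled.union h Tiled.empty (disjoint_empty_right S)

theorem Tiled.disjUnion {S T : Finset V} (hS : Tiled R m S) (hT : Tiled R m T)
    (hd : Disjoint S T) : Tiled R m (S ∪ T) := by
  induction hS with
  | empty => simpa using hT
  | union h1 h2 h3 ih =>
    rw [union_assoc]
    rw [disjoint_union_left] at hd
    exact Tiled.union h1 (ih hd.2) (disjoint_union_right.2 ⟨h3, hd.1⟩)

theorem Tiled.biUnion {I : Type*} [DecidableEq I] {J : Finset I} {f : I → Finset V}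
    (hf : ∀ i ∈ J, Tiled R m (f i)) (hd : ∀ i ∈ J, ∀ j ∈ J, i ≠ j → Disjoint (f i) (f j)) :
    Tiled R m (J.biUnion f) := by
  induction J using Finset.induction_on with
  | empty => simpa using Tiled.empty
  | insert i J hi ih =>
    rw [biUnion_insert]
    refine (hf i (mem_insert_self _ _)).disjUnion (ih (fun j hj => hf j (mem_insert_of_mem hj))
      fun j hj k hk => hd j (mem_insert_of_mem hj) k (mem_insert_of_mem hk)) ?_
    rw [disjoint_biUnion_right]
    exact fun j hj => hd i (mem_insert_self _ _) j (mem_insert_of_mem hj) fun h => hi (h ▸ hj)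

theorem Tiled.of_injective {I : Type*} [Fintype I] {φ : I → Fin 4 × Fin m → V}
    (hφ : Function.Injective fun q : I × (Fin 4 × Fin m) => φ q.1 q.2)
    (hR : ∀ i, BlowupHom R (φ i)) :
    Tiled R m (univ.image fun q : I × (Fin 4 × Fin m) => φ q.1 q.2) := by
  classical
  have e : (univ.image fun q : I × (Fin 4 × Fin m) => φ q.1 q.2) =
      univ.biUnion fun i => univ.image (φ i) := by
    ext v
    simp
  rw [e]
  refine Tiled.biUnion (fun i _ => IsTile.tiled ⟨φ i, fun k l h => ?_, hR i, rfl⟩)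
    fun i _ j _ hij => ?_
  · exact (Prod.mk.inj (@hφ (i, k) (i, l) h)).2
  · rw [disjoint_left]
    intro v hv hv'
    obtain ⟨k, -, hk⟩ := mem_image.1 hv
    obtain ⟨l, -, hl⟩ := mem_image.1 hv'
    exact hij (Prod.mk.inj (@hφ (i, k) (j, l) (hk.trans hl.symm))).1

end Tiled

section Connectors

variable {V : Type*} {m : ℕ} (R : V → V → V → V → Prop) (k₀ : Fin 4 × Fin m)

/-- Extend a function by the value `x` at `k₀`. -/
def fill {κ : Type*} [DecidableEq κ] (k₀ : κ) (x : V) (s : {k // k ≠ k₀} → V) (k : κ) : V :=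
  if h : k = k₀ then x else s ⟨k, h⟩

/-- Both `x` and `y` complete `s` to a copy of the complete `4`-partite `4`-graph. -/
def IsConnector (x y : V) (s : {k // k ≠ k₀} → V) : Prop :=
  BlowupHom R (fill k₀ x s) ∧ BlowupHom R (fill k₀ y s)

/-- Three consecutive connectors, joining `x` to `y`. -/
def IsConnectorChain (x y : V) (g : Fin 2 ⊕ Fin 3 × {k // k ≠ k₀} → V) : Prop :=
  ∀ t : Fin 3, IsConnector R k₀ (![x, g (Sum.inl 0), g (Sum.inl 1), y] t.castSucc)
    (![x, g (Sum.inl 0), g (Sum.inl 1), y] t.succ) fun k => g (Sum.inr (t, k))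

/-- A copy of the complete `4`-partite `4`-graph, joined by chains to the points of `Q`. -/
def IsGadget (Q : Fin 4 × Fin m → V)
    (g : (Fin 4 × Fin m) ⊕ (Fin 4 × Fin m) × (Fin 2 ⊕ Fin 3 × {k // k ≠ k₀}) → V) : Prop :=
  BlowupHom R (fun k => g (Sum.inl k)) ∧
    ∀ i, IsConnectorChain R k₀ (Q i) (g (Sum.inl i)) fun z => g (Sum.inr (i, z))

variable {R k₀}

section Absorb

variable [DecidableEq V]

theorem IsConnectorChain.tiled_left {x y : V} {g : Fin 2 ⊕ Fin 3 × {k // k ≠ k₀} → V}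
    (h : IsConnectorChain R k₀ x y g) (hg : Function.Injective g) (hx : ∀ z, g z ≠ x) :
    Tiled R m (insert x (univ.image g)) := by
  have key := Tiled.of_injective (R := R) (I := Fin 3) (φ := fun t =>
    fill k₀ (![x, g (Sum.inl 0), g (Sum.inl 1), y] t.castSucc) fun k => g (Sum.inr (t, k))) ?_
    fun t => (h t).1
  · convert key using 1
    ext v
    simp only [mem_insert, mem_image, mem_univ, true_and, Prod.exists]
    constructor
    · rintro (rfl | ⟨z | ⟨t, k⟩, rfl⟩)
      · exact ⟨0, k₀.1, k₀.2, by simp [fill]⟩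
      · fin_cases z
        · exact ⟨1, k₀.1, k₀.2, by simp [fill]⟩
        · exact ⟨2, k₀.1, k₀.2, by simp [fill]⟩
      · exact ⟨t, k.1.1, k.1.2, by simp [fill, k.2]⟩
    · rintro ⟨t, a, b, rfl⟩
      by_cases hk : (a, b) = k₀
      · fin_cases t <;> simp [fill, hk]
      · exact Or.inr ⟨Sum.inr (t, ⟨(a, b), hk⟩), by simp [fill, hk]⟩
  · rintro ⟨t, k⟩ ⟨t', k'⟩ h
    by_cases hk : k = k₀ <;> by_cases hk' : k' = k₀
    · subst hk hk'
      fin_cases t <;> fin_cases t' <;> simp_all [fill, hg.eq_iff, eq_comm]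
    · simp only [fill, hk, hk', dite_true, dite_false] at h
      fin_cases t <;> first | exact absurd h.symm (hx _) | exact absurd (hg h) (by simp)
    · simp only [fill, hk, hk', dite_true, dite_false] at h
      fin_cases t' <;> first | exact absurd h (hx _) | exact absurd (hg h) (by simp)
    · simp_all [fill, hg.eq_iff]

theorem IsConnectorChain.tiled_right {x y : V} {g : Fin 2 ⊕ Fin 3 × {k // k ≠ k₀} → V}
    (h : IsConnectorChain R k₀ x y g) (hg : Function.Injective g) (hy : ∀ z, g z ≠ y) :
    Tiled R m (insert y (univ.image g)) := by
  have key := Tiled.of_injective (R := R) (I := Fin 3) (φ := fun t =>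
    fill k₀ (![x, g (Sum.inl 0), g (Sum.inl 1), y] t.succ) fun k => g (Sum.inr (t, k))) ?_
    fun t => (h t).2
  · convert key using 1
    ext v
    simp only [mem_insert, mem_image, mem_univ, true_and, Prod.exists]
    constructor
    · rintro (rfl | ⟨z | ⟨t, k⟩, rfl⟩)
      · exact ⟨2, k₀.1, k₀.2, by simp [fill]⟩
      · fin_cases z
        · exact ⟨0, k₀.1, k₀.2, by simp [fill]⟩
        · exact ⟨1, k₀.1, k₀.2, by simp [fill]⟩
      · exact ⟨t, k.1.1, k.1.2, by simp [fill, k.2]⟩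
    · rintro ⟨t, a, b, rfl⟩
      by_cases hk : (a, b) = k₀
      · fin_cases t <;> simp [fill, hk]
      · exact Or.inr ⟨Sum.inr (t, ⟨(a, b), hk⟩), by simp [fill, hk]⟩
  · rintro ⟨t, k⟩ ⟨t', k'⟩ h
    by_cases hk : k = k₀ <;> by_cases hk' : k' = k₀
    · subst hk hk'
      fin_cases t <;> fin_cases t' <;> simp_all [fill, hg.eq_iff, eq_comm]
    · simp only [fill, hk, hk', dite_true, dite_false] at h
      fin_cases t <;> first | exact absurd h.symm (hy _) | exact absurd (hg h) (by simp)
    · simp only [fill, hk, hk', dite_true, dite_false] at h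
      fin_cases t' <;> first | exact absurd h (hy _) | exact absurd (hg h) (by simp)
    · simp_all [fill, hg.eq_iff]

end Absorb

end Connectors

section Gadgets

variable {V : Type*} [DecidableEq V] {m : ℕ} {R : V → V → V → V → Prop} {k₀ : Fin 4 × Fin m}
  {Q : Fin 4 × Fin m → V}
  {g : (Fin 4 × Fin m) ⊕ (Fin 4 × Fin m) × (Fin 2 ⊕ Fin 3 × {k // k ≠ k₀}) → V}

theorem IsGadget.tiled (h : IsGadget R k₀ Q g) (hg : Function.Injective g) :
    Tiled R m (univ.image g) := by
  have e : univ.image g = univ.biUnion fun i =>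
      insert (g (Sum.inl i)) (univ.image fun z => g (Sum.inr (i, z))) := by
    ext v
    simp only [mem_image, mem_univ, true_and, mem_biUnion, mem_insert, Sum.exists, Prod.exists]
    aesop
  rw [e]
  refine Tiled.biUnion (fun i _ => (h.2 i).tiled_right (fun a b hab => ?_) fun z hz => ?_)
    fun i _ j _ hij => ?_
  · simpa using hg hab
  · simpa using hg hz
  · rw [disjoint_left]
    intro v hv hv'
    simp only [mem_insert, mem_image, mem_univ, true_and] at hv hv'
    rcases hv with rfl | ⟨z, rfl⟩ <;> rcases hv' with hv' | ⟨z', hv'⟩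
    · exact hij (by simpa using hg hv')
    · simpa using hg hv'
    · simpa using hg hv'
    · exact hij (by simpa using (Prod.mk.inj (Sum.inr.inj (hg hv'))).1.symm)

theorem IsGadget.tiled_union (h : IsGadget R k₀ Q g) (hg : Function.Injective g)
    (hQ : Function.Injective Q) (hgQ : ∀ w k, g w ≠ Q k) :
    Tiled R m (univ.image g ∪ univ.image Q) := by
  have e : univ.image g ∪ univ.image Q = (univ.image fun k => g (Sum.inl k)) ∪
      univ.biUnion fun i => insert (Q i) (univ.image fun z => g (Sum.inr (i, z))) := by
    ext v
    simp only [mem_union, mem_image, mem_univ, true_and, mem_biUnion, mem_insert, Sum.exists,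
      Prod.exists]
    aesop
  rw [e]
  refine (IsTile.tiled ⟨_, fun a b hab => by simpa using hg hab, h.1, rfl⟩).disjUnion
    (Tiled.biUnion (fun i _ => (h.2 i).tiled_left (fun a b hab => ?_) fun z => hgQ _ _)
    fun i _ j _ hij => ?_) ?_
  · simpa using hg hab
  · rw [disjoint_left]
    intro v hv hv'
    simp only [mem_insert, mem_image, mem_univ, true_and] at hv hv'
    rcases hv with rfl | ⟨z, rfl⟩ <;> rcases hv' with hv' | ⟨z', hv'⟩
    · exact hij (hQ hv')
    · exact hgQ _ _ hv'
    · exact hgQ _ _ hv'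
    · exact hij (by simpa using (Prod.mk.inj (Sum.inr.inj (hg hv'))).1.symm)
  · rw [disjoint_biUnion_right]
    intro i _
    rw [disjoint_left]
    intro v hv hv'
    simp only [mem_insert, mem_image, mem_univ, true_and] at hv hv'
    obtain ⟨k, rfl⟩ := hv
    rcases hv' with hv' | ⟨z', hv'⟩
    · exact hgQ _ _ hv'
    · simpa using hg hv'

end Gadgets

theorem card_ge_of_sections {A I B V : Type*} [Fintype I] [DecidableEq I] [Nonempty I]
    {good : Finset (A ⊕ I × B → V)} {P : Finset (A → V)} {C : (A → V) → I → Finset (B → V)}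
    (hgood : ∀ p ∈ P, ∀ h : I → B → V, (∀ i, h i ∈ C p i) →
      Sum.elim p (fun q => h q.1 q.2) ∈ good) {a b : ℝ} (hb : 0 ≤ b)
    (hP : a ≤ #P) (hC : ∀ p ∈ P, ∀ i, b ≤ #(C p i)) : a * b ^ Fintype.card I ≤ #good := by
  have h1 : #(P.sigma fun p => Fintype.piFinset (C p)) ≤ #good := by
    refine card_le_card_of_injOn (fun q => Sum.elim q.1 fun z => q.2 z.1 z.2) ?_ ?_
    · rintro ⟨p, h⟩ hq
      simp only [coe_sigma, Set.mem_sigma_iff, mem_coe, Fintype.mem_piFinset] at hq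
      exact hgood p hq.1 h hq.2
    · rintro ⟨p, h⟩ _ ⟨p', h'⟩ _ e
      have e1 : p = p' := funext fun x => congrFun e (Sum.inl x)
      have e2 : h = h' := funext fun i => funext fun x => congrFun e (Sum.inr (i, x))
      rw [e1, e2]
  refine le_trans ?_ (Nat.cast_le.2 h1)
  rw [card_sigma, Nat.cast_sum]
  have h2 : ∀ p ∈ P, b ^ Fintype.card I ≤ (#(Fintype.piFinset (C p)) : ℝ) := fun p hp => by
    rw [Fintype.card_piFinset, Nat.cast_prod, ← card_univ, ← prod_const]
    exact prod_le_prod (fun _ _ => hb) fun i _ => hC p hp i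
  refine (mul_le_mul_of_nonneg_right hP (pow_nonneg hb _)).trans ?_
  have := card_nsmul_le_sum P _ _ h2
  rwa [nsmul_eq_mul] at this

section Counting

variable {V : Type*} [Fintype V] {m : ℕ} {R : V → V → V → V → Prop} {k₀ : Fin 4 × Fin m}

open Classical in
/-- The triples forming an edge together with `x`. -/
noncomputable def link (R : V → V → V → V → Prop) (x : V) : Finset (V × V × V) :=
  {τ | R x τ.1 τ.2.1 τ.2.2}

theorem MinDegreeGE.card_link {κ : ℝ} (h : MinDegreeGE R κ) (x : V) :
    κ * (Fintype.card (V × V × V) : ℝ) ≤ #(link R x) := by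
  classical
  have := h x
  rw [link, card_filter]
  push_cast
  simp only [Fintype.sum_prod_type, Fintype.card_prod]
  push_cast
  refine le_of_eq_of_le (by ring) (this.trans (le_of_eq ?_))
  rfl

open Classical in
theorem card_isConnector_ge (hk₀ : k₀.1 = 0) {δ : ℝ} (hδ : 0 ≤ δ) {x y : V}
    (h : FamilyClose (link R) δ x y) :
    δ ^ m ^ 4 * (Fintype.card V : ℝ) ^ Fintype.card {k // k ≠ k₀} ≤
      (#{s | IsConnector R k₀ x y s} : ℝ) := by
  have hn : (0 : ℝ) < Fintype.card V := Nat.cast_pos.2 (Fintype.card_pos_iff.2 ⟨x⟩)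
  have h1 := card_blowupHom_ge (fun a b c d => R a b c d ∧ R x b c d ∧ R y b c d) hδ m (by
    rw [FamilyClose, Fintype.card_prod, Fintype.card_prod] at h
    push_cast at h
    refine le_of_eq_of_le (by ring) (h.trans (le_of_eq ?_))
    have e : ∀ τ ∈ link R x ∩ link R y, cover (link R) τ =
        ∑ a, (if R a τ.1 τ.2.1 τ.2.2 ∧ R x τ.1 τ.2.1 τ.2.2 ∧ R y τ.1 τ.2.1 τ.2.2
          then 1 else 0 : ℝ) := by
      intro τ hτ
      simp only [link, mem_inter, mem_filter, mem_univ, true_and] at hτ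
      simp only [cover, link, mem_filter, mem_univ, true_and, hτ.1, hτ.2, and_true, card_filter]
      push_cast
      rfl
    rw [sum_congr rfl e, sum_subset (subset_univ _), sum_comm]
    · simp only [Fintype.sum_prod_type]
      congr! 9
    · intro τ _ hτ
      simp only [link, mem_inter, mem_filter, mem_univ, true_and] at hτ
      exact sum_eq_zero fun a _ => if_neg fun h => hτ h.2)
  have h2 : #{φ : Fin 4 × Fin m → V |
      BlowupHom (fun a b c d => R a b c d ∧ R x b c d ∧ R y b c d) φ} ≤
      #{s | IsConnector R k₀ x y s} * Fintype.card V := by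
    rw [← card_univ (α := V), ← card_product]
    refine card_le_card_of_injOn (fun φ => (fun k => φ k, φ k₀)) ?_ ?_
    · intro φ hφ
      simp only [mem_coe, mem_filter, mem_univ, true_and, mem_product, and_true] at hφ ⊢
      have hf : ∀ z k, k ≠ k₀ → fill k₀ z (fun k : {k // k ≠ k₀} => φ k) k = φ k := fun z k hk => by
        simp [fill, hk]
      have hf' : ∀ z (c : Fin 4) i, c ≠ 0 →
          fill k₀ z (fun k : {k // k ≠ k₀} => φ k) (c, i) = φ (c, i) := fun z c i hc =>
        hf z _ fun h => hc (by rw [← hk₀, ← h])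
      constructor <;> intro i j k l <;>
        rw [hf' _ 1 _ (by decide), hf' _ 2 _ (by decide), hf' _ 3 _ (by decide)] <;>
        by_cases hi : ((0, i) : Fin 4 × Fin m) = k₀
      · rw [hi, fill, dif_pos rfl]
        exact (hφ i j k l).2.1
      · rw [hf _ _ hi]
        exact (hφ i j k l).1
      · rw [hi, fill, dif_pos rfl]
        exact (hφ i j k l).2.2
      · rw [hf _ _ hi]
        exact (hφ i j k l).1
    · intro φ _ ψ _ h
      funext k
      by_cases hk : k = k₀
      · rw [hk]
        exact (Prod.mk.inj h).2
      · exact congrFun (Prod.mk.inj h).1 ⟨k, hk⟩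
  have h3 := h1.trans (Nat.cast_le.2 h2)
  have hc : Fintype.card {k // k ≠ k₀} + 1 = 4 * m := by
    have hpos : 0 < Fintype.card (Fin 4 × Fin m) := Fintype.card_pos_iff.2 ⟨k₀⟩
    have h4 : Fintype.card (Fin 4 × Fin m) = 4 * m := by simp
    rw [Fintype.card_subtype_compl, Fintype.card_subtype_eq, ← h4]
    omega
  rw [← hc, pow_succ (Fintype.card V : ℝ), ← mul_assoc] at h3
  push_cast at h3
  exact le_of_mul_le_mul_right h3 hn

open Classical in
theorem card_isConnectorChain_ge (hk₀ : k₀.1 = 0) (hR : MinDegreeGE R (9 / 16)) (x y : V) :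
    ((1 / 128) ^ 2 * ((1 / 65536) ^ m ^ 4) ^ 3) *
      (Fintype.card V : ℝ) ^ Fintype.card (Fin 2 ⊕ Fin 3 × {k // k ≠ k₀}) ≤
      (#{g | IsConnectorChain R k₀ x y g} : ℝ) := by
  have : Nonempty V := ⟨x⟩
  set n : ℝ := (Fintype.card V : ℝ) with hn
  have h1 := card_ge_of_sections (good := ({g | IsConnectorChain R k₀ x y g} : Finset _))
    (P := ({p : Fin 2 → V | FamilyClose (link R) (1 / 65536) x (p 0) ∧
        FamilyClose (link R) (1 / 65536) (p 0) (p 1) ∧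
        FamilyClose (link R) (1 / 65536) (p 1) y} : Finset _))
    (C := fun p t => ({s | IsConnector R k₀ (![x, p 0, p 1, y] t.castSucc)
      (![x, p 0, p 1, y] t.succ) s} : Finset _))
    (a := (n / 128) ^ 2)
    (b := (1 / 65536) ^ m ^ 4 * n ^ Fintype.card {k // k ≠ k₀}) ?_ (by positivity) ?_ ?_
  · refine le_of_eq_of_le ?_ h1
    rw [Fintype.card_sum, Fintype.card_prod, Fintype.card_fin, Fintype.card_fin]
    ring
  · intro p _ h hh
    rw [mem_filter]
    exact ⟨mem_univ _, fun t => (mem_filter.1 (hh t)).2⟩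
  · exact card_close_paths_ge (fun u => hR.card_link u) x y
  · intro p hp t
    simp only [mem_filter, mem_univ, true_and] at hp
    refine card_isConnector_ge hk₀ (by norm_num) ?_
    fin_cases t
    · exact hp.1
    · exact hp.2.1
    · exact hp.2.2

open Classical in
theorem card_isGadget_ge (hk₀ : k₀.1 = 0) (hR : MinDegreeGE R (9 / 16)) (Q : Fin 4 × Fin m → V) :
    ((9 / 16) ^ m ^ 4 * ((1 / 128) ^ 2 * ((1 / 65536) ^ m ^ 4) ^ 3) ^ (4 * m)) *
      (Fintype.card V : ℝ) ^ Fintype.card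
        ((Fin 4 × Fin m) ⊕ (Fin 4 × Fin m) × (Fin 2 ⊕ Fin 3 × {k // k ≠ k₀})) ≤
      (#{g | IsGadget R k₀ Q g} : ℝ) := by
  set n : ℝ := (Fintype.card V : ℝ) with hn
  have : Nonempty (Fin 4 × Fin m) := ⟨k₀⟩
  have h1 := card_ge_of_sections (good := ({g | IsGadget R k₀ Q g} : Finset _))
    (P := ({φ | BlowupHom R φ} : Finset _))
    (C := fun p i => ({g | IsConnectorChain R k₀ (Q i) (p i) g} : Finset _))
    (a := (9 / 16) ^ m ^ 4 * n ^ (4 * m))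
    (b := ((1 / 128) ^ 2 * ((1 / 65536) ^ m ^ 4) ^ 3) *
      n ^ Fintype.card (Fin 2 ⊕ Fin 3 × {k // k ≠ k₀})) ?_ (by positivity) ?_ ?_
  · refine le_of_eq_of_le ?_ h1
    rw [Fintype.card_sum, Fintype.card_prod (Fin 4 × Fin m),
      show Fintype.card (Fin 4 × Fin m) = 4 * m by simp, pow_add, mul_comm (4 * m), pow_mul n,
      mul_pow _ (n ^ _)]
    generalize ((1 / 128 : ℝ) ^ 2 * ((1 / 65536) ^ m ^ 4) ^ 3) ^ (4 * m) = c
    ring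
  · intro p hp h hh
    rw [mem_filter] at hp ⊢
    exact ⟨mem_univ _, hp.2, fun t => (mem_filter.1 (hh t)).2⟩
  · refine card_blowupHom_ge R (by norm_num) m ?_
    have := card_nsmul_le_sum univ (fun a => ∑ b, ∑ c, ∑ d, (if R a b c d then 1 else 0 : ℝ)) _
      fun a _ => hR a
    rw [card_univ, nsmul_eq_mul, ← hn] at this
    refine le_of_eq_of_le ?_ this
    ring
  · exact fun p _ i => card_isConnectorChain_ge hk₀ hR _ _

end Counting

section Greedy

theorem card_apply_eq_mul_card {ι α : Type*} [Fintype ι] [DecidableEq ι] [Fintype α]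
    [DecidableEq α] (i : ι) (v : α) :
    #{g : ι → α | g i = v} * Fintype.card α ≤ Fintype.card α ^ Fintype.card ι := by
  rw [← Fintype.card_fun, ← card_univ (α := α), ← card_univ, ← card_product]
  refine card_le_card_of_injOn (fun p => Function.update p.1 i p.2) (fun _ _ => mem_univ _) ?_
  rintro ⟨g, a⟩ hg ⟨g', a'⟩ hg' h
  simp only [coe_product, Set.mem_prod, mem_coe, mem_filter, mem_univ, true_and, and_true]
    at hg hg' h
  have h1 : a = a' := by simpa using congrFun h i
  refine Prod.ext (funext fun j => ?_) h1
  by_cases hj : j = i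
  · subst hj
    exact hg.trans hg'.symm
  · simpa [hj] using congrFun h j

variable {Ω V 𝒬 : Type*} [Fintype Ω] [DecidableEq Ω] [Fintype V] [DecidableEq V] [Fintype 𝒬]

theorem card_not_disjoint_image_mul_card (W : Finset V) :
    #{x : Ω → V | ¬ Disjoint (univ.image x) W} * Fintype.card V ≤
      Fintype.card Ω * #W * Fintype.card V ^ Fintype.card Ω := by
  have h : ({x : Ω → V | ¬ Disjoint (univ.image x) W} : Finset _) ⊆
      (univ ×ˢ W : Finset (Ω × V)).biUnion fun p => {x : Ω → V | x p.1 = p.2} := by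
    intro x hx
    simp only [mem_filter, mem_univ, true_and, not_disjoint_iff, mem_image] at hx
    obtain ⟨_, ⟨w, rfl⟩, hw⟩ := hx
    simp only [mem_biUnion, mem_product, mem_univ, true_and, mem_filter]
    exact ⟨(w, x w), hw, rfl⟩
  refine (Nat.mul_le_mul_right _ ((card_le_card h).trans card_biUnion_le)).trans ?_
  rw [sum_mul]
  refine (sum_le_card_nsmul _ _ _ fun p _ => card_apply_eq_mul_card p.1 p.2).trans ?_
  rw [smul_eq_mul, card_product, card_univ]

open Classical in
/-- Derandomised selection of vertex-disjoint members from a dense family: the potential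
`∑ 2 ^ (-#good)` decreases geometrically. -/
theorem exists_disjoint_family [Nonempty Ω] [Nonempty 𝒬] (good : 𝒬 → (Ω → V) → Prop) {c : ℝ}
    (hc : 0 < c) (hgood : ∀ Q, c * (Fintype.card V : ℝ) ^ Fintype.card Ω ≤ #{x | good Q x})
    (K : ℕ) (hK : (K : ℝ) * (Fintype.card Ω : ℝ) ^ 2 ≤ c / 2 * Fintype.card V) :
    ∃ F : Finset (Ω → V), #F = K ∧ (∀ x ∈ F, ∃ Q, good Q x) ∧
      (∀ x ∈ F, ∀ y ∈ F, x ≠ y → Disjoint (univ.image x) (univ.image y)) ∧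
      ∑ Q, (1 / 2 : ℝ) ^ #{x ∈ F | good Q x} ≤ Fintype.card 𝒬 * (1 - c / 4) ^ K := by
  induction K with
  | zero => exact ⟨∅, by simp⟩
  | succ K ih =>
    set L := Fintype.card Ω with hL
    set n : ℝ := (Fintype.card V : ℝ) with hn
    have hLpos : (1 : ℝ) ≤ L := by exact_mod_cast Fintype.card_pos
    push_cast at hK
    obtain ⟨F, hF, hF1, hF2, hF3⟩ := ih (by nlinarith)
    have hnpos : 0 < n := by
      have : 0 < c / 2 * n := lt_of_lt_of_le (by positivity) hK
      exact (mul_pos_iff_of_pos_left (by positivity)).1 this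
    set W := F.biUnion fun x => univ.image x with hW
    have hWc : #W ≤ K * L := by
      refine card_biUnion_le.trans ((sum_le_card_nsmul _ _ L fun x _ => card_image_le).trans ?_)
      rw [hF, smul_eq_mul]
    set X : Finset (Ω → V) := {x | Disjoint (univ.image x) W ∧ ∃ Q, good Q x} with hX
    have hcard : ∀ Q, c / 2 * n ^ L ≤ (#{x ∈ X | good Q x} : ℝ) := by
      intro Q
      have h1 : #{x | good Q x} ≤ #{x ∈ X | good Q x} +
          #{x : Ω → V | ¬ Disjoint (univ.image x) W} := by
        rw [← card_union_of_disjoint]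
        · refine card_le_card fun x hx => ?_
          simp only [hX, mem_filter, mem_univ, true_and, mem_union] at hx ⊢
          by_cases h : Disjoint (univ.image x) W
          · exact Or.inl ⟨⟨h, Q, hx⟩, hx⟩
          · exact Or.inr h
        · rw [disjoint_left]
          intro x hx hx'
          simp only [hX, mem_filter, mem_univ, true_and] at hx hx'
          exact hx' hx.1.1
      have h2 : (#{x : Ω → V | ¬ Disjoint (univ.image x) W} : ℝ) * n ≤ c / 2 * n ^ L * n := by
        have h3 : (#{x : Ω → V | ¬ Disjoint (univ.image x) W} : ℝ) * n ≤ L * #W * n ^ L := by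
          rw [hn, hL]
          exact_mod_cast card_not_disjoint_image_mul_card (Ω := Ω) W
        have h4 : (#W : ℝ) ≤ K * L := by exact_mod_cast hWc
        calc _ ≤ L * (K * L) * n ^ L := h3.trans (by gcongr)
          _ ≤ (c / 2 * n) * n ^ L :=
            mul_le_mul_of_nonneg_right (by nlinarith) (by positivity)
          _ = _ := by ring
      have h5 := le_of_mul_le_mul_right h2 hnpos
      have h6 : (#{x | good Q x} : ℝ) ≤ #{x ∈ X | good Q x} +
          #{x : Ω → V | ¬ Disjoint (univ.image x) W} := by exact_mod_cast h1
      linarith [hgood Q]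
    have hXn : (#X : ℝ) ≤ n ^ L := by
      have : #X ≤ Fintype.card V ^ L := by
        rw [hL, ← Fintype.card_fun]
        exact card_le_univ _
      rw [hn]
      exact_mod_cast this
    have hXne : X.Nonempty := by
      obtain ⟨Q⟩ := ‹Nonempty 𝒬›
      have h1 : (0 : ℝ) < #{x ∈ X | good Q x} := lt_of_lt_of_le (by positivity) (hcard Q)
      exact (card_pos.1 (Nat.cast_pos.1 h1)).mono (filter_subset _ _)
    have hnot : ∀ x ∈ X, x ∉ F := by
      intro x hx hxF
      obtain ⟨w⟩ := ‹Nonempty Ω›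
      simp only [hX, mem_filter, mem_univ, true_and] at hx
      exact disjoint_left.1 hx.1 (mem_image_of_mem x (mem_univ w))
        (mem_biUnion.2 ⟨x, hxF, mem_image_of_mem x (mem_univ w)⟩)
    obtain ⟨x, hx, hle⟩ : ∃ x ∈ X, ∑ Q, (1 / 2 : ℝ) ^ #{y ∈ insert x F | good Q y} ≤
        (1 - c / 4) * ∑ Q, (1 / 2 : ℝ) ^ #{y ∈ F | good Q y} := by
      refine exists_le_of_sum_le hXne ?_
      rw [sum_comm, sum_const, nsmul_eq_mul, mul_sum, mul_sum]
      refine sum_le_sum fun Q _ => ?_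
      have h1 : ∀ x ∈ X, (1 / 2 : ℝ) ^ #{y ∈ insert x F | good Q y} =
          (1 / 2 : ℝ) ^ #{y ∈ F | good Q y} * (1 - 1 / 2 * if good Q x then 1 else 0) := by
        intro x hx
        rw [filter_insert]
        split_ifs with h
        · rw [card_insert_of_notMem fun h => hnot x hx (mem_filter.1 h).1, pow_succ]
          norm_num
        · norm_num
      rw [sum_congr rfl h1, ← mul_sum, sum_sub_distrib, ← mul_sum, sum_boole, sum_const,
        nsmul_eq_mul, mul_one]
      have h2 : (#X : ℝ) - 1 / 2 * #{x ∈ X | good Q x} ≤ #X * (1 - c / 4) := by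
        nlinarith [hcard Q]
      refine (mul_le_mul_of_nonneg_left h2 (by positivity)).trans_eq (by ring)
    refine ⟨insert x F, by rw [card_insert_of_notMem (hnot x hx), hF], ?_, ?_, ?_⟩
    · simp only [hX, mem_filter, mem_univ, true_and] at hx
      simpa using ⟨hx.2, hF1⟩
    · simp only [hX, mem_filter, mem_univ, true_and, hW, disjoint_biUnion_right] at hx
      intro y hy z hz hyz
      rw [mem_insert] at hy hz
      rcases hy with rfl | hy <;> rcases hz with rfl | hz
      · exact absurd rfl hyz
      · exact hx.1 z hz
      · exact (hx.1 y hy).symm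
      · exact hF2 y hy z hz hyz
    · have hc4 : 0 ≤ 1 - c / 4 := by
        obtain ⟨Q⟩ := ‹Nonempty 𝒬›
        have h1 : (#{x ∈ X | good Q x} : ℝ) ≤ #X := by exact_mod_cast card_filter_le _ _
        have h2 : c / 2 * n ^ L ≤ 1 * n ^ L := by linarith [hcard Q]
        have := le_of_mul_le_mul_right h2 (by positivity)
        linarith
      exact hle.trans ((mul_le_mul_of_nonneg_left hF3 hc4).trans_eq (by ring))

end Greedy

theorem exists_forall_mul_pow_lt_two_pow (k D : ℕ) (hD : 0 < D) :
    ∃ T : ℕ, ∀ t : ℕ, T ≤ t → ((D : ℝ) * (t + 1)) ^ k < 2 ^ t := by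
  have hD' : (0 : ℝ) < D := Nat.cast_pos.2 hD
  have h := tendsto_pow_const_mul_const_pow_of_abs_lt_one k (r := (1 / 2 : ℝ))
    (by rw [abs_of_pos] <;> norm_num)
  have h0 : (0 : ℝ) < 1 / (2 * D ^ k) := by positivity
  obtain ⟨T, hT⟩ := Filter.eventually_atTop.1 (h.eventually_lt_const h0)
  refine ⟨T, fun t ht => ?_⟩
  have h1 := hT (t + 1) (by omega)
  rw [lt_div_iff₀ (by positivity), div_pow, one_pow, pow_succ (2 : ℝ), mul_one_div,
    div_mul_eq_mul_div, div_lt_one (by positivity)] at h1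
  push_cast at h1
  rw [mul_pow]
  linarith

section Absorbing

variable {V : Type*} [DecidableEq V] {m : ℕ} {R : V → V → V → V → Prop}

open Classical in
theorem tiled_biUnion_union {Ω : Type*} [Fintype Ω] (s : ℕ) (F : Finset (Ω → V)) (W : Finset V)
    (hF : ∀ x ∈ F, Tiled R m (univ.image x))
    (hd : ∀ x ∈ F, ∀ y ∈ F, x ≠ y → Disjoint (univ.image x) (univ.image y))
    (hW : Disjoint (F.biUnion fun x => univ.image x) W) (hs : #W = 4 * m * s)
    (hQ : ∀ Q : Fin 4 × Fin m → V, Function.Injective Q → s ≤ #{x ∈ F |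
      (∀ w k, x w ≠ Q k) → Tiled R m (univ.image x ∪ univ.image Q)}) :
    Tiled R m ((F.biUnion fun x => univ.image x) ∪ W) := by
  induction s generalizing F W with
  | zero =>
    rw [mul_zero, card_eq_zero] at hs
    rw [hs, union_empty]
    exact Tiled.biUnion hF hd
  | succ s ih =>
    obtain ⟨S, hSW, hS⟩ := exists_subset_card_eq (s := W) (n := 4 * m) (by rw [hs]; nlinarith)
    let e : Fin 4 × Fin m ≃ S := Fintype.equivOfCardEq (by simp [hS])
    have heS : univ.image (fun k => (e k : V)) = S := by
      ext v
      simp only [mem_image, mem_univ, true_and]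
      exact ⟨fun ⟨k, hk⟩ => hk ▸ (e k).2, fun hv => ⟨e.symm ⟨v, hv⟩, by simp⟩⟩
    obtain ⟨x, hx⟩ := card_pos.1
      (lt_of_lt_of_le s.succ_pos (hQ (fun k => (e k : V)) fun a b h => e.injective (Subtype.ext h)))
    rw [mem_filter, heS] at hx
    have hdisj : ∀ y ∈ F, Disjoint (univ.image y) W := fun y hy =>
      (disjoint_biUnion_left _ _ _).1 hW y hy
    have h1 := hx.2 fun w k h => disjoint_left.1 (hdisj x hx.1) (mem_image_of_mem x (mem_univ w))
      (hSW (h ▸ (e k).2))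
    have h2 := ih (F.erase x) (W \ S) (fun y hy => hF y (mem_of_mem_erase hy))
      (fun y hy z hz => hd y (mem_of_mem_erase hy) z (mem_of_mem_erase hz))
      ((disjoint_biUnion_left _ _ _).2 fun y hy =>
        disjoint_of_subset_right sdiff_subset (hdisj y (mem_of_mem_erase hy)))
      (by rw [card_sdiff_of_subset hSW, hs, hS, mul_add, mul_one, Nat.add_sub_cancel])
      fun Q hQi => by
        have h3 := hQ Q hQi
        rw [filter_erase]
        have h4 := pred_card_le_card_erase (s := {x ∈ F |
          (∀ w k, x w ≠ Q k) → Tiled R m (univ.image x ∪ univ.image Q)}) (a := x)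
        omega
    have h5 := h1.disjUnion h2 (by
      rw [disjoint_union_left, disjoint_union_right, disjoint_union_right]
      refine ⟨⟨(disjoint_biUnion_right _ _ _).2 fun y hy => hd x hx.1 y (mem_of_mem_erase hy)
        (ne_of_mem_erase hy).symm, disjoint_of_subset_right sdiff_subset (hdisj x hx.1)⟩,
        (disjoint_biUnion_right _ _ _).2 fun y hy => ?_, disjoint_sdiff⟩
      exact (disjoint_of_subset_right hSW (hdisj y (mem_of_mem_erase hy))).symm)
    have h6 : (F.biUnion fun x => univ.image x) =
        univ.image x ∪ (F.erase x).biUnion fun x => univ.image x := by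
      rw [← biUnion_insert (t := fun x : Ω → V => univ.image x), insert_erase hx.1]
    rw [h6]
    convert h5 using 1
    nth_rewrite 1 [← union_sdiff_of_subset hSW]
    ac_rfl

end Absorbing

open Classical in
theorem exists_absorbing_set_of_gadgets {Ω : Type*} [Fintype Ω] [Nonempty Ω]
    {m : ℕ} (hm : 0 < m) {c₀ β : ℝ} (hc₀ : 0 < c₀) (hβ : 0 < β) :
    ∃ α > (0 : ℝ), ∃ N₀ : ℕ, ∀ (V : Type) [Fintype V] (R : V → V → V → V → Prop)
      (gad : (Fin 4 × Fin m → V) → (Ω → V) → Prop),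
      (∀ Q, c₀ * (Fintype.card V : ℝ) ^ Fintype.card Ω ≤ #{x | gad Q x}) →
      (∀ Q x, gad Q x → Function.Injective x → Tiled R m (univ.image x)) →
      (∀ Q x, gad Q x → Function.Injective x → Function.Injective Q → (∀ w k, x w ≠ Q k) →
        Tiled R m (univ.image x ∪ univ.image Q)) →
      N₀ ≤ Fintype.card V →
      ∃ U : Finset V, (#U : ℝ) ≤ β * Fintype.card V ∧
        ∀ W : Finset V, Disjoint U W → 4 * m ∣ #W → (#W : ℝ) ≤ α * Fintype.card V →
          Tiled R m (U ∪ W) := by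
  set L := Fintype.card Ω with hL
  obtain ⟨c, hc, hcc₀, hc1⟩ : ∃ c > 0, 2 * c ≤ c₀ ∧ c ≤ 1 :=
    ⟨min (c₀ / 2) 1, by positivity, by linarith [min_le_left (c₀ / 2) 1], min_le_right _ _⟩
  obtain ⟨q, hq⟩ := exists_pow_lt_of_lt_one (show (0 : ℝ) < 1 / 4 by norm_num)
    (show 1 - c / 4 < 1 by linarith)
  obtain ⟨D, hD⟩ := exists_nat_ge (max 1 (max (2 * q * L ^ 2 / c) (q * L / β)))
  obtain ⟨hD1, hD2, hD3⟩ : 1 ≤ (D : ℝ) ∧ 2 * q * L ^ 2 / c ≤ D ∧ q * L / β ≤ D := by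
    simpa only [max_le_iff] using hD
  have hDpos : 0 < D := Nat.cast_pos.1 (lt_of_lt_of_le one_pos hD1)
  have hDpos' : (0 : ℝ) < D := Nat.cast_pos.2 hDpos
  obtain ⟨T, hT⟩ := exists_forall_mul_pow_lt_two_pow (4 * m) D hDpos
  obtain ⟨N₁, hN₁⟩ := exists_nat_ge ((L : ℝ) ^ 2 / c)
  refine ⟨1 / (2 * D), by positivity, max N₁ (D * T + 2 * D), fun V _ R gad hgad hT1 hT2 hN => ?_⟩
  set n := Fintype.card V with hn
  have hN2 : D * T + 2 * D ≤ n := (le_max_right _ _).trans hN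
  have hN1 : (L : ℝ) ^ 2 / c ≤ n := hN₁.trans (Nat.cast_le.2 ((le_max_left _ _).trans hN))
  have hnpos : 0 < n := by omega
  have hnpos' : (0 : ℝ) < n := Nat.cast_pos.2 hnpos
  have : Nonempty V := Fintype.card_pos_iff.1 hnpos
  set t := n / D with ht
  have htT : T ≤ t := (Nat.le_div_iff_mul_le hDpos).2 (by nlinarith)
  have htn : (D : ℝ) * t ≤ n := by exact_mod_cast Nat.mul_div_le n D
  have hnt : (n : ℝ) < D * (t + 1) := by exact_mod_cast Nat.lt_mul_div_succ n hDpos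
  have hN3 : 2 * (D : ℝ) ≤ n := by
    have : 2 * D ≤ n := by omega
    exact_mod_cast this
  obtain ⟨good, hgood⟩ : ∃ good : (Fin 4 × Fin m → V) → (Ω → V) → Prop,
      ∀ Q x, good Q x ↔ gad Q x ∧ Function.Injective x := ⟨_, fun _ _ => Iff.rfl⟩
  obtain ⟨F, hFK, hF1, hF2, hF3⟩ := exists_disjoint_family (Ω := Ω) (V := V)
    (𝒬 := Fin 4 × Fin m → V) good hc
    (fun Q => by
      have h2 : (#{x : Ω → V | ¬ Set.InjOn x (univ : Finset Ω)} : ℝ) * n ≤ L ^ 2 * n ^ L := by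
        have := card_not_injOn_le (α := V) (univ : Finset Ω)
        rw [card_univ] at this
        exact_mod_cast this
      have h3 : (#{x : Ω → V | ¬ Set.InjOn x (univ : Finset Ω)} : ℝ) ≤ c * n ^ L := by
        refine le_of_mul_le_mul_right (h2.trans ?_) hnpos'
        rw [div_le_iff₀ hc] at hN1
        calc _ ≤ (n * c : ℝ) * n ^ L := mul_le_mul_of_nonneg_right hN1 (by positivity)
          _ = _ := by ring
      have h4 : #{x : Ω → V | gad Q x} ≤
          #{x : Ω → V | good Q x} +
            #{x : Ω → V | ¬ Set.InjOn x (univ : Finset Ω)} := by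
        refine (card_le_card fun x hx => ?_).trans (card_union_le _ _)
        simp only [mem_filter, mem_univ, true_and, mem_union, coe_univ, Set.injOn_univ, hgood] at hx ⊢
        tauto
      have h5 : (#{x : Ω → V | gad Q x} : ℝ) ≤
          #{x : Ω → V | good Q x} +
            #{x : Ω → V | ¬ Set.InjOn x (univ : Finset Ω)} := by exact_mod_cast h4
      have h6 : 2 * c * (n : ℝ) ^ L ≤ c₀ * n ^ L :=
        mul_le_mul_of_nonneg_right hcc₀ (by positivity)
      have h7 := hgad Q
      linarith) (q * t) (by
        push_cast
        rw [div_le_iff₀ hc] at hD2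
        have h1 : 2 * q * (L : ℝ) ^ 2 * t ≤ c * n := by
          calc _ ≤ D * c * t := mul_le_mul_of_nonneg_right hD2 (by positivity)
            _ = c * (D * t) := by ring
            _ ≤ _ := by gcongr
        linarith)
  have hr : 0 ≤ 1 - c / 4 := by linarith
  have hmany : ∀ Q : Fin 4 × Fin m → V,
      t ≤ #{x ∈ F | good Q x} := by
    intro Q
    have h1 := (single_le_sum (f := fun Q => (1 / 2 : ℝ) ^
      #{x ∈ F | good Q x}) (fun _ _ => by positivity)
      (mem_univ Q)).trans hF3
    have h2 : (Fintype.card (Fin 4 × Fin m → V) : ℝ) * (1 - c / 4) ^ (q * t) < (1 / 2) ^ t := by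
      have h3 : (Fintype.card (Fin 4 × Fin m → V) : ℝ) = n ^ (4 * m) := by simp [hn]
      rw [h3, pow_mul (1 - c / 4)]
      have h4 : (n : ℝ) ^ (4 * m) < 2 ^ t :=
        (pow_le_pow_left₀ hnpos'.le hnt.le _).trans_lt (hT t htT)
      calc _ ≤ (n : ℝ) ^ (4 * m) * (1 / 4) ^ t := by gcongr
        _ < 2 ^ t * (1 / 4) ^ t := by gcongr
        _ = _ := by rw [← mul_pow]; norm_num
    exact ((pow_lt_pow_iff_right_of_lt_one₀ (by norm_num) (by norm_num)).1 (h1.trans_lt h2)).le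
  refine ⟨F.biUnion fun x => univ.image x, ?_, fun W hUW ⟨s, hs⟩ hW => ?_⟩
  · have h1 : #(F.biUnion fun x => univ.image x) ≤ q * t * L := by
      refine card_biUnion_le.trans ((sum_le_card_nsmul _ _ L fun x _ => card_image_le).trans ?_)
      rw [hFK, smul_eq_mul]
    have h2 : (#(F.biUnion fun x => univ.image x) : ℝ) ≤ q * t * L := by exact_mod_cast h1
    refine h2.trans ?_
    rw [div_le_iff₀ hβ] at hD3
    calc (q * t * L : ℝ) = q * L * t := by ring
      _ ≤ D * β * t := mul_le_mul_of_nonneg_right hD3 (by positivity)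
      _ = β * (D * t) := by ring
      _ ≤ _ := by gcongr
  · have hst : s ≤ t := by
      have h1 : s ≤ #W := by rw [hs]; nlinarith
      have h2 : (s : ℝ) ≤ 1 / (2 * D) * n := (Nat.cast_le.2 h1).trans hW
      rw [div_mul_eq_mul_div, le_div_iff₀ (by positivity)] at h2
      have h3 : (s : ℝ) < t + 1 := by
        by_contra! h
        nlinarith
      have h4 : s < t + 1 := by exact_mod_cast h3
      omega
    refine tiled_biUnion_union s F W (fun x hx => ?_) (fun x hx y hy hxy => hF2 x hx y hy hxy)
      hUW hs fun Q hQ => ?_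
    · obtain ⟨Q, hQ⟩ := hF1 x hx
      exact hT1 Q x ((hgood Q x).1 hQ).1 ((hgood Q x).1 hQ).2
    · refine hst.trans ((hmany Q).trans (card_le_card fun x hx => ?_))
      rw [mem_filter, hgood] at hx
      rw [mem_filter]
      exact ⟨hx.1, hT2 Q x hx.2.1 hx.2.2 hQ⟩

open Classical in
theorem exists_absorbing_set {m : ℕ} (hm : 0 < m) {β : ℝ} (hβ : 0 < β) :
    ∃ α > (0 : ℝ), ∃ N₀ : ℕ, ∀ (V : Type) [Fintype V]
      (R : V → V → V → V → Prop), MinDegreeGE R (9 / 16) → N₀ ≤ Fintype.card V →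
      ∃ U : Finset V, (#U : ℝ) ≤ β * Fintype.card V ∧
        ∀ W : Finset V, Disjoint U W → 4 * m ∣ #W → (#W : ℝ) ≤ α * Fintype.card V →
          Tiled R m (U ∪ W) := by
  have : Nonempty ((Fin 4 × Fin m) ⊕ (Fin 4 × Fin m) ×
      (Fin 2 ⊕ Fin 3 × {k : Fin 4 × Fin m // k ≠ (0, ⟨0, hm⟩)})) := ⟨Sum.inl (0, ⟨0, hm⟩)⟩
  obtain ⟨α, hα, N₀, h⟩ := exists_absorbing_set_of_gadgets
    (Ω := (Fin 4 × Fin m) ⊕ (Fin 4 × Fin m) ×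
      (Fin 2 ⊕ Fin 3 × {k : Fin 4 × Fin m // k ≠ (0, ⟨0, hm⟩)})) hm
    (c₀ := (9 / 16) ^ m ^ 4 * ((1 / 128) ^ 2 * ((1 / 65536) ^ m ^ 4) ^ 3) ^ (4 * m))
    (by positivity) hβ
  refine ⟨α, hα, N₀, fun V _ R hR hN => ?_⟩
  exact h V R (IsGadget R (0, ⟨0, hm⟩)) (fun Q => by
    convert card_isGadget_ge (k₀ := ((0, ⟨0, hm⟩) : Fin 4 × Fin m)) rfl hR Q)
      (fun Q x hQ hx => hQ.tiled hx)
    (fun Q x hQ hx hQi => hQ.tiled_union hx hQi) hN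

section Combine

variable {V : Type*} [Fintype V] {R : V → V → V → V → Prop}

theorem MinDegreeGE.mono {κ κ' : ℝ} (h : MinDegreeGE R κ) (hκ : κ' ≤ κ) : MinDegreeGE R κ' :=
  fun a => (mul_le_mul_of_nonneg_right hκ (by positivity)).trans (h a)

theorem Tiled.dvd_card {V : Type*} [DecidableEq V] {R : V → V → V → V → Prop} {m : ℕ}
    {S : Finset V} (h : Tiled R m S) : 4 * m ∣ #S := by
  induction h with
  | empty => simp
  | union h1 _ h3 ih =>
    obtain ⟨φ, hφ, _, rfl⟩ := h1
    rw [card_union_of_disjoint h3, card_image_of_injective _ hφ]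
    exact dvd_add (by simp) ih

theorem sum_le_sum_notMem_add [DecidableEq V] (U : Finset V) {g : V → ℝ} {B : ℝ}
    (hg : ∀ b, g b ≤ B) : ∑ b, g b ≤ ∑ b : {v // v ∉ U}, g b + #U * B := by
  rw [← Fintype.sum_subtype_add_sum_subtype (fun v => v ∈ U) g, add_comm]
  gcongr
  refine (sum_le_card_nsmul _ _ B ?_).trans_eq ?_
  · exact fun b _ => hg b
  · simp

open Classical in
/-- Deleting few vertices destroys few edges at every vertex. -/
theorem MinDegreeGE.restrict {κ β : ℝ} (h : MinDegreeGE R κ) {U : Finset V}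
    (hU : (#U : ℝ) ≤ β * Fintype.card V) (hβ : 3 * β ≤ κ) :
    MinDegreeGE (fun a b c d : {v // v ∉ U} => R a b c d) (κ - 3 * β) := by
  intro a
  set n : ℝ := (Fintype.card V : ℝ) with hn
  have hle : (Fintype.card {v // v ∉ U} : ℝ) ≤ n := by
    rw [hn]
    exact_mod_cast Fintype.card_subtype_le _
  have hn0 : 0 ≤ n := Nat.cast_nonneg _
  have h0 := h a
  have f1 : ∀ b c d, (if R a b c d then 1 else 0 : ℝ) ≤ 1 := fun b c d => by
    split_ifs <;> norm_num
  have f2 : ∀ b c, ∑ d, (if R a b c d then 1 else 0 : ℝ) ≤ n := fun b c =>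
    (sum_le_card_nsmul univ _ 1 fun d _ => f1 b c d).trans_eq (by simp [hn])
  have f3 : ∀ b, ∑ c, ∑ d, (if R a b c d then 1 else 0 : ℝ) ≤ n * n := fun b =>
    (sum_le_card_nsmul univ _ n fun c _ => f2 b c).trans_eq (by simp [hn])
  have h1 := sum_le_sum_notMem_add U f3
  have h2 : ∑ b : {v // v ∉ U}, ∑ c, ∑ d, (if R a b c d then 1 else 0 : ℝ) ≤
      ∑ b : {v // v ∉ U}, (∑ c : {v // v ∉ U}, ∑ d, (if R a b c d then 1 else 0 : ℝ) + #U * n) :=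
    sum_le_sum fun b _ => sum_le_sum_notMem_add U (f2 b)
  have h3 : ∑ b : {v // v ∉ U}, ∑ c : {v // v ∉ U}, ∑ d, (if R a b c d then 1 else 0 : ℝ) ≤
      ∑ b : {v // v ∉ U}, ∑ c : {v // v ∉ U},
        (∑ d : {v // v ∉ U}, (if R a b c d then 1 else 0 : ℝ) + #U * 1) :=
    sum_le_sum fun b _ => sum_le_sum fun c _ => sum_le_sum_notMem_add U (f1 b c)
  simp only [sum_add_distrib, sum_const, card_univ, nsmul_eq_mul, mul_one] at h2 h3
  set k : ℝ := (Fintype.card {v // v ∉ U} : ℝ) with hk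
  have hk0 : 0 ≤ k := Nat.cast_nonneg _
  have hu0 : (0 : ℝ) ≤ #U := Nat.cast_nonneg _
  have e1 : (#U : ℝ) * (n * n) ≤ β * n * (n * n) := mul_le_mul_of_nonneg_right hU (by positivity)
  have e2 : k * (#U * n) ≤ β * n * (n * n) := by
    calc _ ≤ n * (#U * n) := mul_le_mul_of_nonneg_right hle (by positivity)
      _ = #U * (n * n) := by ring
      _ ≤ _ := e1
  have e3 : k * (k * #U) ≤ β * n * (n * n) := by
    calc _ ≤ k * (n * #U) := by gcongr
      _ = k * (#U * n) := by ring
      _ ≤ _ := e2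
  have e4 : (κ - 3 * β) * k ^ 3 ≤ (κ - 3 * β) * n ^ 3 :=
    mul_le_mul_of_nonneg_left (pow_le_pow_left₀ hk0 hle 3) (by linarith)
  have e5 : (κ - 3 * β) * n ^ 3 ≤
      ∑ b : {v // v ∉ U}, ∑ c : {v // v ∉ U}, ∑ d : {v // v ∉ U},
        (if R a b c d then 1 else 0 : ℝ) := by
    linarith
  exact e4.trans e5

end Combine

open Classical in
theorem tiled_univ_of_minDegreeGE {m : ℕ} (hm : 0 < m) {γ : ℝ} (hγ : 0 < γ) :
    ∃ N₀ : ℕ, ∀ (V : Type) [Fintype V] (R : V → V → V → V → Prop),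
      MinDegreeGE R (37 / 64 + γ) → N₀ ≤ Fintype.card V → 4 * m ∣ Fintype.card V →
      Tiled R m univ := by
  obtain ⟨β, hβ, hβγ, hβ2⟩ : ∃ β > 0, 3 * β ≤ γ / 2 ∧ β ≤ 1 / 2 :=
    ⟨min (γ / 6) (1 / 2), by positivity, by linarith [min_le_left (γ / 6) (1 / 2)],
      min_le_right _ _⟩
  obtain ⟨α, hα, N₁, h1⟩ := exists_absorbing_set hm hβ
  obtain ⟨N₂, h2⟩ := exists_almost_tiling (half_pos hγ) hα hm
  refine ⟨max N₁ (2 * N₂), fun V _ R hR hN hdvd => ?_⟩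
  obtain ⟨U, hU, hW⟩ := h1 V R (hR.mono (by linarith)) ((le_max_left _ _).trans hN)
  set n := Fintype.card V with hn
  have hc : Fintype.card {v // v ∉ U} + #U = n := by
    rw [Fintype.card_subtype_compl, Fintype.card_coe]
    exact Nat.sub_add_cancel (card_le_univ U)
  have hc' : (Fintype.card {v // v ∉ U} : ℝ) + #U = n := by exact_mod_cast hc
  have hN2 : 2 * N₂ ≤ n := (le_max_right _ _).trans hN
  have hn0 : (0 : ℝ) ≤ n := Nat.cast_nonneg _
  obtain ⟨t, ⟨φ, hφ, hφR⟩, ht⟩ := h2 {v // v ∉ U} (fun a b c d => R a b c d)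
    ((hR.restrict hU (by linarith)).mono (by linarith)) (by
      have h3 : (2 : ℝ) * N₂ ≤ n := by exact_mod_cast hN2
      have h4 : (N₂ : ℝ) ≤ Fintype.card {v // v ∉ U} := by nlinarith
      exact_mod_cast h4)
  have hinj : Function.Injective fun q : Fin t × (Fin 4 × Fin m) => (φ q.1 q.2 : V) :=
    Subtype.val_injective.comp hφ
  set T : Finset V := univ.image fun q : Fin t × (Fin 4 × Fin m) => (φ q.1 q.2 : V) with hT
  have hTt : Tiled R m T := Tiled.of_injective (φ := fun s k => (φ s k : V)) hinj
    fun s i j k l => hφR s i j k l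
  have hTc : #T = 4 * m * t := by
    rw [hT, card_image_of_injective _ hinj]
    simp [mul_comm]
  have hUT : Disjoint U T := by
    rw [disjoint_right]
    intro v hv
    obtain ⟨q, -, rfl⟩ := mem_image.1 hv
    exact (φ q.1 q.2).2
  have hcW : #(univ \ (U ∪ T)) + (#U + #T) = n := by
    rw [← card_union_of_disjoint hUT, card_sdiff_add_card_eq_card (subset_univ _), card_univ]
  have hdW : 4 * m ∣ #(univ \ (U ∪ T)) := by
    have h5 : 4 * m ∣ #U := by
      have := hW ∅ (disjoint_empty_right U) (by simp) (by simpa using by positivity)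
      rw [union_empty] at this
      exact this.dvd_card
    refine (Nat.dvd_add_left (dvd_add h5 ?_)).1 (hcW ▸ hdvd)
    rw [hTc]
    exact dvd_mul_right _ _
  have hfin := hW (univ \ (U ∪ T)) (disjoint_sdiff.mono_left subset_union_left) hdW (by
    have h5 : (#(univ \ (U ∪ T)) : ℝ) + (#U + 4 * m * t) = n := by
      rw [hTc] at hcW
      exact_mod_cast hcW
    have h6 : α * (Fintype.card {v // v ∉ U} : ℝ) ≤ α * n := by
      have : (0 : ℝ) ≤ #U := Nat.cast_nonneg _
      exact mul_le_mul_of_nonneg_left (by linarith) hα.le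
    linarith)
  convert hfin.disjUnion hTt (disjoint_union_left.2 ⟨hUT, sdiff_disjoint.mono_right
    subset_union_right⟩) using 1
  ext v
  simp only [mem_univ, mem_union, mem_sdiff, true_and, true_iff]
  tauto

section Hypergraph

theorem card_le_six_mul_card_triples {α : Type*} [Fintype α] [DecidableEq α]
    (D : Finset (Finset α)) (hD : ∀ S ∈ D, #S = 3) :
    #D * 6 ≤ #{τ : α × α × α | ({τ.1, τ.2.1, τ.2.2} : Finset α) ∈ D} := by
  have h0 : ∀ τ ∈ ({τ : α × α × α | ({τ.1, τ.2.1, τ.2.2} : Finset α) ∈ D} : Finset _),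
      ({τ.1, τ.2.1, τ.2.2} : Finset α) ∈ D := fun τ hτ => (mem_filter.1 hτ).2
  rw [card_eq_sum_card_fiberwise h0, ← smul_eq_mul]
  refine card_nsmul_le_sum _ _ _ fun S hS => ?_
  obtain ⟨x, y, z, hxy, hxz, hyz, rfl⟩ := card_eq_three.1 (hD S hS)
  have h6 : #({(x, y, z), (x, z, y), (y, x, z), (y, z, x), (z, x, y), (z, y, x)} :
      Finset (α × α × α)) = 6 := by
    simp [hxy, hxz, hyz, hxy.symm, hxz.symm, hyz.symm]
  rw [← h6]
  refine card_le_card fun τ hτ => ?_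
  have h : ({τ.1, τ.2.1, τ.2.2} : Finset α) = {x, y, z} := by
    simp only [mem_insert, mem_singleton] at hτ
    rcases hτ with rfl | rfl | rfl | rfl | rfl | rfl <;> grind
  rw [mem_filter, mem_filter]
  exact ⟨⟨mem_univ _, h ▸ hS⟩, h⟩

variable {n : ℕ} {E : Finset (Finset (Fin n))}

theorem six_mul_degOn_le (v : Fin n) : (6 : ℝ) * degOn E 4 {v} ≤
    ∑ b, ∑ c, ∑ d, (if ({v, b, c, d} : Finset (Fin n)) ∈ E then 1 else 0 : ℝ) := by
  set D : Finset (Finset (Fin n)) := {S | #S = 3 ∧ Disjoint S {v} ∧ S ∪ {v} ∈ E} with hD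
  have h1 : degOn E 4 {v} = #D := by
    rw [degOn, hD, card_singleton, ← Set.ncard_coe_finset (filter _ _), coe_filter]
    simp only [mem_univ, true_and]
  have h2 := card_le_six_mul_card_triples D fun S hS => (mem_filter.1 hS).2.1
  have h3 : #{τ : Fin n × Fin n × Fin n | ({τ.1, τ.2.1, τ.2.2} : Finset (Fin n)) ∈ D} ≤
      #{τ : Fin n × Fin n × Fin n | ({v, τ.1, τ.2.1, τ.2.2} : Finset (Fin n)) ∈ E} := by
    refine card_le_card fun τ hτ => ?_
    simp only [hD, mem_filter, mem_univ, true_and] at hτ ⊢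
    have := hτ.2.2
    rwa [union_comm, singleton_union] at this
  have h4 : ((#D * 6 : ℕ) : ℝ) ≤
      #{τ : Fin n × Fin n × Fin n | ({v, τ.1, τ.2.1, τ.2.2} : Finset (Fin n)) ∈ E} :=
    Nat.cast_le.2 (h2.trans h3)
  rw [h1]
  push_cast [card_filter] at h4
  simp only [Fintype.sum_prod_type] at h4
  linarith

theorem six_mul_choose_three_ge (hn : 2 ≤ n) :
    (n : ℝ) ^ 3 - 6 * n ^ 2 ≤ 6 * (n.choose 3 : ℝ) := by
  have h1 := Nat.pow_sub_le_descFactorial n 3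
  rw [Nat.descFactorial_eq_factorial_mul_choose] at h1
  have h2 : (((n + 1 - 3) ^ 3 : ℕ) : ℝ) ≤ ((Nat.factorial 3 * n.choose 3 : ℕ) : ℝ) :=
    Nat.cast_le.2 h1
  obtain ⟨k, rfl⟩ := Nat.exists_eq_add_of_le hn
  have h3 : 2 + k + 1 - 3 = k := by omega
  rw [h3] at h2
  push_cast [Nat.factorial] at h2 ⊢
  have hk : (0 : ℝ) ≤ k := Nat.cast_nonneg k
  nlinarith

theorem minDegreeGE_of_degOn {γ : ℝ} (hγ : 0 < γ)
    (hn : 12 * (37 / 64 + γ) / γ ≤ n) (h2 : 2 ≤ n)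
    (hE : ∀ v : Fin n, (37 / 64 + γ) * (n.choose 3 : ℝ) ≤ (degOn E 4 {v} : ℝ)) :
    MinDegreeGE (fun a b c d : Fin n => ({a, b, c, d} : Finset (Fin n)) ∈ E)
      (37 / 64 + γ / 2) := by
  intro v
  have h1 := six_mul_degOn_le (E := E) v
  have h3 := hE v
  have h4 := six_mul_choose_three_ge h2
  rw [div_le_iff₀ hγ] at hn
  rw [Fintype.card_fin]
  have h5 : (37 / 64 + γ / 2) * (n : ℝ) ^ 3 ≤ (37 / 64 + γ) * (n ^ 3 - 6 * n ^ 2) := by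
    nlinarith [mul_le_mul_of_nonneg_right hn (sq_nonneg (n : ℝ))]
  have h6 : (37 / 64 + γ) * ((n : ℝ) ^ 3 - 6 * n ^ 2) ≤ (37 / 64 + γ) * (6 * n.choose 3) :=
    mul_le_mul_of_nonneg_left h4 (by positivity)
  refine le_trans ?_ (h1.trans (le_of_eq ?_))
  · linarith
  · congr! 7

theorem exists_eq_of_mem_multipartiteEdges {m : ℕ} {e : Finset (Fin 4 × Fin m)}
    (he : e ∈ multipartiteEdges 4 m) :
    ∃ i j k l, e = {((0 : Fin 4), i), (1, j), (2, k), (3, l)} := by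
  rw [multipartiteEdges, mem_filter] at he
  have h : ∀ c : Fin 4, ∃ i : Fin m, ∀ j, (c, j) ∈ e ↔ j = i := by
    intro c
    obtain ⟨⟨c', i⟩, hi⟩ := card_eq_one.1 (he.2 c)
    have hc : c' = c := by
      have : (c', i) ∈ e.filter fun v => v.1 = c := hi ▸ mem_singleton_self _
      exact (mem_filter.1 this).2
    refine ⟨i, fun j => ?_⟩
    have : (c, j) ∈ (e.filter fun v => v.1 = c) ↔ (c, j) ∈ ({(c', i)} : Finset (Fin 4 × Fin m)) := by
      rw [hi]
    simpa [hc] using this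
  choose f hf using h
  refine ⟨f 0, f 1, f 2, f 3, ?_⟩
  ext ⟨c, j⟩
  rw [hf]
  fin_cases c <;> simp

theorem IsTile.isCopy {m : ℕ} {A : Finset (Fin n)}
    (h : IsTile (fun a b c d : Fin n => ({a, b, c, d} : Finset (Fin n)) ∈ E) m A) :
    IsCopy E (multipartiteEdges 4 m) A := by
  obtain ⟨φ, hφ, hR, rfl⟩ := h
  refine ⟨⟨φ, hφ⟩, by rw [map_eq_image]; rfl, fun e he => ?_⟩
  obtain ⟨i, j, k, l, rfl⟩ := exists_eq_of_mem_multipartiteEdges he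
  simpa using hR i j k l

theorem Tiled.hasFactorOn {m : ℕ} {S : Finset (Fin n)}
    (h : Tiled (fun a b c d : Fin n => ({a, b, c, d} : Finset (Fin n)) ∈ E) m S) :
    HasFactorOn E (multipartiteEdges 4 m) S := by
  induction h with
  | empty => exact ⟨∅, by simp⟩
  | @union A T hA _ hd ih =>
    obtain ⟨P, hP, hPd, rfl⟩ := ih
    refine ⟨insert A P, ?_, ?_, by rw [biUnion_insert]; rfl⟩
    · simpa using ⟨hA.isCopy, hP⟩
    · rw [coe_insert]
      exact hPd.insert fun B hB _ => (disjoint_biUnion_right _ _ _).1 hd B hB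

end Hypergraph

/-- Every large 4-graph with minimum vertex degree at least `(37/64 + γ) C(n,3)` has a
`K₄⁴(m)`-factor. -/
theorem K44m_factor (m : ℕ) (hm : 1 ≤ m) (γ : ℝ) (hγ : 0 < γ) :
    ∃ n₀ : ℕ, ∀ n : ℕ, n₀ ≤ n → 4 * m ∣ n →
      ∀ E : Finset (Finset (Fin n)), (∀ e ∈ E, e.card = 4) →
      (∀ v : Fin n, (37 / 64 + γ) * (n.choose 3 : ℝ) ≤ (degOn E 4 {v} : ℝ)) →
      HasFactorOn E (multipartiteEdges 4 m) (Finset.univ : Finset (Fin n)) := by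
  obtain ⟨N, hN⟩ := tiled_univ_of_minDegreeGE hm (half_pos hγ)
  obtain ⟨M, hM⟩ := exists_nat_ge (12 * (37 / 64 + γ) / γ)
  refine ⟨max N (max M 2), fun n hn hdvd E _ hdeg => Tiled.hasFactorOn ?_⟩
  obtain ⟨h1, h2, h3⟩ : N ≤ n ∧ M ≤ n ∧ 2 ≤ n := by simpa only [max_le_iff] using hn
  convert hN (Fin n) _ (minDegreeGE_of_degOn hγ (hM.trans (Nat.cast_le.2 h2)) h3 hdeg)
    (by rwa [Fintype.card_fin]) (by rwa [Fintype.card_fin])
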